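/- Let α > 1 and set σ := σ(α). Let (k_i)_i be a strictly increasing sequence in ℕ and (ℓ_i)_i a sequence in ℕ such that δ_i := σk_i − ℓ_i ≥ 0 for all i and δ_i/k_i → 0 as i → ∞. If j_{ℓ_i,k_i} − α·ℓ_i → 0 as i → ∞, then δ_i → σ/4. -/

import Mathlib

open Real Set Filter

/-- The Bessel function of the first kind,
`J_ν(x) = Σ_{n=0}^∞ ((−1)ⁿ/(n!·Γ(n+ν+1)))·(x/2)^{2n+ν}`. -/
noncomputable def besselJ (ν x : ℝ) : ℝ :=
  ∑' n : ℕ, ((-1 : ℝ)^n / ((n.factorial : ℝ) * Real.Gamma ((n : ℝ) + ν + 1)))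
    * (x/2) ^ (2*(n:ℝ) + ν)

/-- The function `y ↦ π/(√(y²−1) − arccos(1/y))`, a strictly decreasing bijection
from `(1,∞)` onto `(0,∞)`. -/
noncomputable def sigmaF (y : ℝ) : ℝ :=
  Real.pi / (Real.sqrt (y^2 - 1) - Real.arccos (1/y))


/-! ### Basic facts on Bessel functions of integer order -/

/-- auxiliary entire function -/
noncomputable def hb (n : ℕ) (t : ℝ) : ℝ :=
  ∑' m : ℕ, t ^ m / ((m.factorial : ℝ) * ((m + n).factorial : ℝ))

lemma hb_term_le (n m : ℕ) (t R : ℝ) (ht : |t| ≤ R) :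
    ‖t ^ m / ((m.factorial : ℝ) * ((m + n).factorial : ℝ))‖ ≤ R ^ m / m.factorial := by
  have h1 : (1 : ℝ) ≤ ((m + n).factorial : ℝ) := by exact_mod_cast Nat.factorial_pos _
  have h2 : (0 : ℝ) < (m.factorial : ℝ) := by exact_mod_cast Nat.factorial_pos _
  rw [norm_div, norm_pow, Real.norm_eq_abs, norm_mul, Real.norm_of_nonneg h2.le,
    Real.norm_of_nonneg (by linarith)]
  have h3 : |t| ^ m ≤ R ^ m := pow_le_pow_left₀ (abs_nonneg _) ht m
  have : (0:ℝ) ≤ R ^ m := le_trans (by positivity) h3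
  apply div_le_div₀ this h3 h2
  nlinarith

lemma hb_summable (n : ℕ) (t : ℝ) :
    Summable (fun m : ℕ => t ^ m / ((m.factorial : ℝ) * ((m + n).factorial : ℝ))) :=
  Summable.of_norm_bounded (Real.summable_pow_div_factorial |t|)
    (fun m => hb_term_le n m t _ le_rfl)

lemma hb_hasDerivAt (n : ℕ) (t : ℝ) : HasDerivAt (hb n) (hb (n + 1) t) t := by
  have key : HasDerivAt (fun y => ∑' m : ℕ, y ^ m / ((m.factorial : ℝ) * ((m + n).factorial : ℝ)))
      (∑' m : ℕ, ((m : ℝ) * t ^ (m - 1)) / ((m.factorial : ℝ) * ((m + n).factorial : ℝ))) t := by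
    have hsum : Summable (fun m : ℕ => (m : ℝ) * ((|t| + 1) ^ (m - 1) / m.factorial)) := by
      rw [← summable_nat_add_iff 1]
      refine (Real.summable_pow_div_factorial (|t| + 1)).congr ?_
      intro m
      have h2 : (m.factorial : ℝ) ≠ 0 := by positivity
      rw [Nat.factorial_succ]; push_cast
      field_simp
    refine hasDerivAt_tsum_of_isPreconnected (t := Metric.ball (0:ℝ) (|t| + 1)) (y₀ := t)
      (u := fun m : ℕ => (m : ℝ) * ((|t| + 1) ^ (m - 1) / m.factorial))
      (g := fun m y => y ^ m / ((m.factorial : ℝ) * ((m + n).factorial : ℝ)))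
      (g' := fun m y => ((m : ℝ) * y ^ (m - 1)) / ((m.factorial : ℝ) * ((m + n).factorial : ℝ)))
      hsum Metric.isOpen_ball (convex_ball _ _).isPreconnected ?_ ?_ ?_ (hb_summable n t) ?_
    · intro m y _
      exact (hasDerivAt_pow m y).div_const _
    · intro m y hy
      have hy' : |y| ≤ |t| + 1 := by
        have := Metric.mem_ball.1 hy
        rw [Real.dist_eq, sub_zero] at this; exact this.le
      have h1 : (1 : ℝ) ≤ ((m + n).factorial : ℝ) := by exact_mod_cast Nat.factorial_pos _
      have h2 : (0 : ℝ) < (m.factorial : ℝ) := by exact_mod_cast Nat.factorial_pos _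
      rw [norm_div, norm_mul, norm_pow, Real.norm_eq_abs y, norm_mul, Real.norm_of_nonneg h2.le,
        Real.norm_of_nonneg (Nat.cast_nonneg m),
        Real.norm_of_nonneg (Nat.cast_nonneg (m + n).factorial), mul_div_assoc]
      refine mul_le_mul_of_nonneg_left ?_ (Nat.cast_nonneg m)
      apply div_le_div₀ (by positivity) (pow_le_pow_left₀ (abs_nonneg _) hy' _) h2
      nlinarith
    · simp
    · simp
  have e : (∑' m : ℕ, ((m : ℝ) * t ^ (m - 1)) / ((m.factorial : ℝ) * ((m + n).factorial : ℝ)))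
      = hb (n + 1) t := by
    unfold hb
    have hs : Summable (fun m : ℕ =>
        ((m : ℝ) * t ^ (m - 1)) / ((m.factorial : ℝ) * ((m + n).factorial : ℝ))) := by
      rw [← summable_nat_add_iff 1]
      refine (hb_summable (n + 1) t).congr ?_
      intro m
      have h2 : (m.factorial : ℝ) ≠ 0 := by positivity
      rw [Nat.factorial_succ m, Nat.add_sub_cancel, show m + 1 + n = m + (n + 1) by ring]; push_cast
      have h3 : ((m + (n + 1)).factorial : ℝ) ≠ 0 := by positivity
      field_simp
    rw [hs.tsum_eq_zero_add]
    simp only [Nat.cast_zero, zero_mul, zero_div, zero_add]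
    refine tsum_congr ?_
    intro m
    have h2 : (m.factorial : ℝ) ≠ 0 := by positivity
    rw [Nat.factorial_succ m, Nat.add_sub_cancel, show m + 1 + n = m + (n + 1) by ring]; push_cast
    have h3 : ((m + (n + 1)).factorial : ℝ) ≠ 0 := by positivity
    field_simp
  rw [e] at key
  exact key

lemma hb_rec (n : ℕ) (t : ℝ) : hb n t = (n + 1) * hb (n + 1) t + t * hb (n + 2) t := by
  unfold hb
  rw [← tsum_mul_left, ← tsum_mul_left]
  have hs : Summable (fun m : ℕ => (m : ℝ) * (t ^ m / ((m.factorial : ℝ) * ((m + (n + 1)).factorial : ℝ)))) := by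
    rw [← summable_nat_add_iff 1]
    refine ((hb_summable (n + 2) t).mul_left t).congr ?_
    intro m
    have h2 : (m.factorial : ℝ) ≠ 0 := by positivity
    rw [Nat.factorial_succ m, show m + 1 + (n + 1) = m + (n + 2) by ring]; push_cast
    have h3 : ((m + (n + 2)).factorial : ℝ) ≠ 0 := by positivity
    field_simp
    ring
  have e : ∑' m : ℕ, t * (t ^ m / ((m.factorial : ℝ) * ((m + (n + 2)).factorial : ℝ)))
     = ∑' m : ℕ, (m : ℝ) * (t ^ m / ((m.factorial : ℝ) * ((m + (n + 1)).factorial : ℝ))) := by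
    rw [hs.tsum_eq_zero_add]
    simp only [Nat.cast_zero, zero_mul, zero_add]
    refine tsum_congr ?_
    intro m
    have h2 : (m.factorial : ℝ) ≠ 0 := by positivity
    rw [Nat.factorial_succ m, show m + 1 + (n + 1) = m + (n + 2) by ring]; push_cast
    have h3 : ((m + (n + 2)).factorial : ℝ) ≠ 0 := by positivity
    field_simp
    ring
  rw [e, ← ((hb_summable (n + 1) t).mul_left ((n : ℝ) + 1)).tsum_add hs]
  refine tsum_congr ?_
  intro m
  have h2 : (m.factorial : ℝ) ≠ 0 := by positivity
  have h3 : ((m + n).factorial : ℝ) ≠ 0 := by positivity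
  rw [show m + (n + 1) = m + n + 1 by ring, Nat.factorial_succ (m + n)]; push_cast
  have h4 : (m : ℝ) + n + 1 ≠ 0 := by positivity
  field_simp
  ring

/-- Bessel function of integer order. -/
noncomputable def BJ (n : ℕ) (x : ℝ) : ℝ := (x / 2) ^ n * hb n (-(x ^ 2 / 4))

lemma besselJ_eq (n : ℕ) (x : ℝ) : besselJ (n : ℝ) x = BJ n x := by
  unfold besselJ BJ hb
  rw [← tsum_mul_left]
  refine tsum_congr ?_
  intro m
  have e1 : (2 * (m : ℝ) + (n : ℝ)) = ((2 * m + n : ℕ) : ℝ) := by push_cast; ring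
  have e2 : ((m : ℝ) + (n : ℝ) + 1) = ((m + n : ℕ) : ℝ) + 1 := by push_cast; ring
  rw [e1, Real.rpow_natCast, e2, Real.Gamma_nat_eq_factorial]
  have : (-(x ^ 2 / 4)) ^ m = (-1) ^ m * (x / 2) ^ (2 * m) := by
    rw [pow_mul, ← mul_pow]; congr 1; ring
  rw [this, pow_add]
  ring

lemma BJ_hasDerivAt_gen (n : ℕ) (x : ℝ) :
    HasDerivAt (BJ n) ((n * (x / 2) ^ (n - 1) * (1 / 2)) * hb n (-(x ^ 2 / 4)) +
      (x / 2) ^ n * (hb (n + 1) (-(x ^ 2 / 4)) * (-(x / 2)))) x := by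
  have h1 : HasDerivAt (fun y : ℝ => (y / 2) ^ n) (n * (x / 2) ^ (n - 1) * (1 / 2)) x :=
    ((hasDerivAt_id x).div_const 2).pow n
  have h2 : HasDerivAt (fun y : ℝ => -(y ^ 2 / 4)) (-(x / 2)) x := by
    have := ((hasDerivAt_pow 2 x).div_const 4).neg
    refine this.congr_deriv ?_
    push_cast; ring
  have h3 := (hb_hasDerivAt n (-(x ^ 2 / 4))).comp x h2
  exact h1.mul h3

lemma BJ_continuous (n : ℕ) : Continuous (BJ n) :=
  continuous_iff_continuousAt.2 fun x => (BJ_hasDerivAt_gen n x).continuousAt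

lemma BJ_hasDerivAt (n : ℕ) {x : ℝ} (hx : x ≠ 0) :
    HasDerivAt (BJ n) (n / x * BJ n x - BJ (n + 1) x) x := by
  convert BJ_hasDerivAt_gen n x using 1
  unfold BJ
  cases n with
  | zero => simp; ring
  | succ k =>
    rw [Nat.add_sub_cancel]; push_cast
    field_simp
    ring

lemma BJ_rec (n : ℕ) {x : ℝ} (hx : x ≠ 0) :
    BJ n x + BJ (n + 2) x = 2 * (n + 1) / x * BJ (n + 1) x := by
  unfold BJ
  rw [hb_rec n]
  field_simp
  ring

lemma BJ_hasDerivAt' (n : ℕ) {x : ℝ} (hx : x ≠ 0) :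
    HasDerivAt (BJ (n + 1)) (BJ n x - (n + 1) / x * BJ (n + 1) x) x := by
  convert BJ_hasDerivAt (n + 1) hx using 1
  have := BJ_rec n hx
  push_cast
  have e : 2 * ((n:ℝ) + 1) / x * BJ (n + 1) x = 2 * (((n:ℝ) + 1) / x * BJ (n + 1) x) := by ring
  linarith

lemma BJ0_hasDerivAt (x : ℝ) : HasDerivAt (BJ 0) (-BJ 1 x) x := by
  convert BJ_hasDerivAt_gen 0 x using 1
  unfold BJ
  simp; ring

lemma BJ0_zero : BJ 0 0 = 1 := by
  unfold BJ hb
  rw [tsum_eq_single 0]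
  · simp
  · intro m hm; simp [hm]

lemma BJ1_zero : BJ 1 0 = 0 := by simp [BJ]

lemma BJ_energy_hasDerivAt {x : ℝ} (hx : x ≠ 0) :
    HasDerivAt (fun y => BJ 0 y ^ 2 + BJ 1 y ^ 2) (-2 * BJ 1 x ^ 2 / x) x := by
  have h1 := ((BJ0_hasDerivAt x).pow 2).add ((BJ_hasDerivAt' 0 hx).pow 2)
  refine h1.congr_deriv ?_
  simp; ring

lemma BJ_energy_le {x : ℝ} (hx : 0 ≤ x) : BJ 0 x ^ 2 + BJ 1 x ^ 2 ≤ 1 := by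
  have hc : Continuous (fun y => BJ 0 y ^ 2 + BJ 1 y ^ 2) :=
    ((BJ_continuous 0).pow 2).add ((BJ_continuous 1).pow 2)
  have : AntitoneOn (fun y => BJ 0 y ^ 2 + BJ 1 y ^ 2) (Ici 0) := by
    apply antitoneOn_of_deriv_nonpos (convex_Ici 0) hc.continuousOn
    · intro y hy
      rw [interior_Ici] at hy
      exact (BJ_energy_hasDerivAt (ne_of_gt hy)).differentiableAt.differentiableWithinAt
    · intro y hy
      rw [interior_Ici] at hy
      rw [(BJ_energy_hasDerivAt (ne_of_gt hy)).deriv]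
      have hy' : (0:ℝ) < y := hy
      apply div_nonpos_of_nonpos_of_nonneg _ hy'.le
      nlinarith [sq_nonneg (BJ 1 y)]
  have := this (mem_Ici.2 le_rfl) (mem_Ici.2 hx) hx
  simpa [BJ0_zero, BJ1_zero] using this

lemma BJ0_abs_le {x : ℝ} (hx : 0 ≤ x) : |BJ 0 x| ≤ 1 := by
  have := BJ_energy_le hx
  rw [← sq_le_one_iff_abs_le_one]; nlinarith [sq_nonneg (BJ 1 x)]

lemma BJ1_abs_le {x : ℝ} (hx : 0 ≤ x) : |BJ 1 x| ≤ 1 := by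
  have := BJ_energy_le hx
  rw [← sq_le_one_iff_abs_le_one]; nlinarith [sq_nonneg (BJ 0 x)]

lemma BJ_energy_pos {a : ℝ} (ha : 0 < a) : 0 < BJ 0 a ^ 2 + BJ 1 a ^ 2 := by
  by_contra hcon
  have hE : BJ 0 a ^ 2 + BJ 1 a ^ 2 = 0 :=
    le_antisymm (not_lt.1 hcon) (by positivity)
  have hc : Continuous (fun y => y ^ 2 * (BJ 0 y ^ 2 + BJ 1 y ^ 2)) :=
    (continuous_pow 2).mul (((BJ_continuous 0).pow 2).add ((BJ_continuous 1).pow 2))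
  have hd : ∀ y : ℝ, 0 < y → HasDerivAt (fun y => y ^ 2 * (BJ 0 y ^ 2 + BJ 1 y ^ 2))
      (2 * y * BJ 0 y ^ 2) y := by
    intro y hy
    refine ((hasDerivAt_pow 2 y).mul (BJ_energy_hasDerivAt hy.ne')).congr_deriv ?_
    field_simp
    ring
  have hm : MonotoneOn (fun y => y ^ 2 * (BJ 0 y ^ 2 + BJ 1 y ^ 2)) (Ici 0) := by
    apply monotoneOn_of_deriv_nonneg (convex_Ici 0) hc.continuousOn
    · intro y hy
      rw [interior_Ici] at hy
      exact (hd y hy).differentiableAt.differentiableWithinAt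
    · intro y hy
      rw [interior_Ici] at hy
      rw [(hd y hy).deriv]
      have hy' : (0:ℝ) < y := hy
      positivity
  have hz : ∀ y ∈ Ioc 0 a, BJ 0 y = 0 := by
    intro y hy
    have h1 := hm (mem_Ici.2 hy.1.le) (mem_Ici.2 ha.le) hy.2
    simp only [hE, mul_zero] at h1
    have h2 : 0 < y ^ 2 := by have := hy.1; positivity
    have h3 : BJ 0 y ^ 2 + BJ 1 y ^ 2 ≤ 0 := by
      by_contra h; push Not at h
      have := mul_pos h2 h; linarith
    have : BJ 0 y ^ 2 = 0 := by nlinarith [sq_nonneg (BJ 0 y), sq_nonneg (BJ 1 y)]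
    exact pow_eq_zero_iff (two_ne_zero) |>.1 this
  have hl : Tendsto (BJ 0) (nhdsWithin 0 (Ioi 0)) (nhds 1) := by
    have := (BJ_continuous 0).tendsto 0
    rw [BJ0_zero] at this
    exact this.mono_left nhdsWithin_le_nhds
  have hl2 : Tendsto (BJ 0) (nhdsWithin 0 (Ioi 0)) (nhds 0) := by
    refine tendsto_const_nhds.congr' ?_
    filter_upwards [Ioc_mem_nhdsGT ha] with y hy
    exact (hz y hy).symm
  exact one_ne_zero (tendsto_nhds_unique hl hl2)

lemma BJ_not_both (n : ℕ) {a : ℝ} (ha : 0 < a) (h0 : BJ n a = 0) (h1 : BJ (n + 1) a = 0) : False := by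
  induction n with
  | zero =>
    have := BJ_energy_pos ha
    simp only [zero_add] at h1
    rw [h0, h1] at this; simp at this
  | succ k ih =>
    apply ih _ h0
    have := BJ_rec k ha.ne'
    rw [h0, show k + 2 = k + 1 + 1 from rfl, h1] at this
    simpa using this


/-! ### Prüfer angle -/

lemma pruefer (d : ℝ) (a b ω ρ μ : ℝ → ℝ)
    (ha : ∀ x, d < x → HasDerivAt a (ω x * b x + μ x * a x) x)
    (hb : ∀ x, d < x → HasDerivAt b (-(ω x * (1 + ρ x) * a x) + μ x * b x) x)
    (hne : ∀ x, d < x → 0 < a x ^ 2 + b x ^ 2)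
    (hω : ContinuousOn ω (Ioi d)) (hρ : ContinuousOn ρ (Ioi d)) :
    ∃ φ : ℝ → ℝ, ∀ x, d < x →
      HasDerivAt φ (ω x * (1 + ρ x * (a x ^ 2 / (a x ^ 2 + b x ^ 2)))) x ∧
      b x * sin (φ x) = a x * cos (φ x) := by
  set f : ℝ → ℝ := fun x => ω x * (1 + ρ x * (a x ^ 2 / (a x ^ 2 + b x ^ 2))) with hf
  have hac : ContinuousOn a (Ioi d) := fun x hx => (ha x hx).continuousAt.continuousWithinAt
  have hbc : ContinuousOn b (Ioi d) := fun x hx => (hb x hx).continuousAt.continuousWithinAt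
  have hfc : ContinuousOn f (Ioi d) := by
    refine hω.mul (continuousOn_const.add (hρ.mul ((hac.pow 2).div ((hac.pow 2).add (hbc.pow 2)) ?_)))
    intro x hx; exact (hne x hx).ne'
  set x0 := d + 1
  have hx0 : d < x0 := by simp [x0]
  set φ : ℝ → ℝ := fun x => Complex.arg ⟨b x0, a x0⟩ + ∫ t in x0..x, f t with hφ
  have hφd : ∀ x, d < x → HasDerivAt φ (f x) x := by
    intro x hx
    have hsub : uIcc x0 x ⊆ Ioi d := by
      intro y hy
      have := hy.1
      exact lt_of_lt_of_le (lt_min hx0 hx) this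
    have h1 : HasDerivAt (fun u => ∫ t in x0..u, f t) (f x) x := by
      apply intervalIntegral.integral_hasDerivAt_right
      · exact (hfc.mono hsub).intervalIntegrable
      · exact hfc.stronglyMeasurableAtFilter isOpen_Ioi x hx
      · exact hfc.continuousAt (Ioi_mem_nhds hx)
    exact h1.const_add _
  refine ⟨φ, fun x hx => ⟨hφd x hx, ?_⟩⟩
  have hKd : ∀ x, d < x → HasDerivAt
      (fun x => (b x * sin (φ x) - a x * cos (φ x)) ^ 2 / (a x ^ 2 + b x ^ 2)) 0 x := by
    intro x hx
    have hs := (hφd x hx).sin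
    have hc := (hφd x hx).cos
    have h1 := ((((hb x hx).mul hs).sub ((ha x hx).mul hc)).pow 2).div
      (((ha x hx).pow 2).add ((hb x hx).pow 2)) (hne x hx).ne'
    refine h1.congr_deriv ?_
    simp only [Pi.add_apply, Pi.pow_apply, Pi.sub_apply, Pi.mul_apply]
    have hne' := (hne x hx).ne'
    simp only [hf]
    rw [div_eq_zero_iff]; left
    field_simp
    ring
  have hcont := (convex_Ioi d).is_const_of_fderivWithin_eq_zero (𝕜 := ℝ)
    (f := fun x => (b x * sin (φ x) - a x * cos (φ x)) ^ 2 / (a x ^ 2 + b x ^ 2))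
    (fun y hy => (hKd y hy).differentiableAt.differentiableWithinAt)
    (fun y hy => by
      rw [fderivWithin_of_isOpen isOpen_Ioi hy]
      have := (hKd y hy).hasFDerivAt.fderiv
      rw [this]; ext; simp) hx hx0
  have h0 : b x0 * sin (φ x0) - a x0 * cos (φ x0) = 0 := by
    have : φ x0 = Complex.arg ⟨b x0, a x0⟩ := by simp [hφ]
    have hz : (⟨b x0, a x0⟩ : ℂ) ≠ 0 := by
      intro h
      have h1 := congrArg Complex.re h
      have h2 := congrArg Complex.im h
      simp only [Complex.zero_re, Complex.zero_im] at h1 h2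
      have := hne x0 hx0
      rw [h1, h2] at this; simp at this
    rw [this, Complex.sin_arg, Complex.cos_arg hz]
    ring
  simp only [h0] at hcont
  simp only [ne_eq, OfNat.ofNat_ne_zero, not_false_eq_true, zero_pow, zero_div, div_eq_zero_iff,
    (hne x hx).ne', or_false, pow_eq_zero_iff] at hcont
  linarith

/-- phase derivative -/
noncomputable def om (n : ℕ) (x : ℝ) : ℝ := √(x ^ 2 - n ^ 2) / x
/-- error term -/
noncomputable def rh (n : ℕ) (x : ℝ) : ℝ := (x ^ 4 + 4 * n ^ 2 * x ^ 2) / (4 * (x ^ 2 - n ^ 2) ^ 3)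
/-- phase -/
noncomputable def SS (n : ℕ) (x : ℝ) : ℝ := √(x ^ 2 - n ^ 2) - n * arccos (n / x)

lemma g_pos {n : ℕ} {x : ℝ} (hx : (n : ℝ) < x) : 0 < x ^ 2 - (n : ℝ) ^ 2 := by
  have : (0 : ℝ) ≤ n := Nat.cast_nonneg n
  nlinarith

lemma sqrt_g_hasDerivAt {n : ℕ} {x : ℝ} (hx : (n : ℝ) < x) :
    HasDerivAt (fun y : ℝ => √(y ^ 2 - (n : ℝ) ^ 2)) (x / √(x ^ 2 - n ^ 2)) x := by
  have h := ((hasDerivAt_pow 2 x).sub_const ((n : ℝ) ^ 2)).sqrt (g_pos hx).ne'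
  refine h.congr_deriv ?_
  have : √(x ^ 2 - (n : ℝ) ^ 2) ≠ 0 := (Real.sqrt_pos.2 (g_pos hx)).ne'
  push_cast
  field_simp

lemma SS_hasDerivAt {n : ℕ} {x : ℝ} (hx : (n : ℝ) < x) : HasDerivAt (SS n) (om n x) x := by
  have hn : (0 : ℝ) ≤ n := Nat.cast_nonneg n
  have hx0 : 0 < x := lt_of_le_of_lt hn hx
  have hg := g_pos hx
  have hlt : (n : ℝ) / x < 1 := (div_lt_one hx0).2 hx
  have hge : 0 ≤ (n : ℝ) / x := by positivity
  have h1 : HasDerivAt (fun y : ℝ => (n : ℝ) / y) (-(n : ℝ) / x ^ 2) x := by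
    refine ((hasDerivAt_inv hx0.ne').const_mul (n : ℝ)).congr_deriv ?_
    field_simp
  have h2 := (Real.hasDerivAt_arccos (by linarith) hlt.ne).comp x h1
  have h3 := (sqrt_g_hasDerivAt hx).sub (h2.const_mul (n : ℝ))
  refine h3.congr_deriv ?_
  have e : √(1 - ((n : ℝ) / x) ^ 2) = √(x ^ 2 - n ^ 2) / x := by
    rw [show 1 - ((n : ℝ) / x) ^ 2 = (x ^ 2 - n ^ 2) / x ^ 2 by field_simp, Real.sqrt_div hg.le,
      Real.sqrt_sq hx0.le]
  have hs : √(x ^ 2 - (n : ℝ) ^ 2) ≠ 0 := (Real.sqrt_pos.2 hg).ne'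
  have hs2 : √(x ^ 2 - (n : ℝ) ^ 2) ^ 2 = x ^ 2 - n ^ 2 := Real.sq_sqrt hg.le
  rw [e, om]
  field_simp
  rw [hs2]

/-- existence of phase function for Bessel -/
lemma exists_phase (n : ℕ) : ∃ φ : ℝ → ℝ, ∀ x, (n : ℝ) < x →
    (∃ q, 0 ≤ q ∧ q ≤ 1 ∧ HasDerivAt φ (om n x * (1 + rh n x * q)) x) ∧
    (BJ n x * (n + x ^ 2 / (2 * (x ^ 2 - n ^ 2))) - x * BJ (n + 1) x) * sin (φ x) =
      √(x ^ 2 - n ^ 2) * BJ n x * cos (φ x) ∧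
    (BJ n x = 0 ↔ sin (φ x) = 0) := by
  have hn : (0 : ℝ) ≤ n := Nat.cast_nonneg n
  have hbne : ∀ x, (n:ℝ) < x → √(x ^ 2 - n ^ 2) * BJ n x = 0 →
      BJ n x * (n + x ^ 2 / (2 * (x ^ 2 - n ^ 2))) - x * BJ (n + 1) x ≠ 0 := by
    intro x hx h h2
    have hx0 : 0 < x := lt_of_le_of_lt hn hx
    have hs : √(x ^ 2 - (n : ℝ) ^ 2) ≠ 0 := (Real.sqrt_pos.2 (g_pos hx)).ne'
    have h3 : BJ n x = 0 := by simpa [hs] using h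
    rw [h3] at h2
    have h4 : BJ (n + 1) x = 0 := by simpa [hx0.ne'] using h2
    exact BJ_not_both n hx0 h3 h4
  obtain ⟨φ, hφ⟩ := pruefer n (fun x => √(x ^ 2 - n ^ 2) * BJ n x)
    (fun x => BJ n x * (n + x ^ 2 / (2 * (x ^ 2 - n ^ 2))) - x * BJ (n + 1) x)
    (om n) (rh n) (fun x => x / (2 * (x ^ 2 - n ^ 2)))
    (by
      intro x hx
      have hx0 : 0 < x := lt_of_le_of_lt hn hx
      have hg := g_pos hx
      have hs : √(x ^ 2 - (n : ℝ) ^ 2) ≠ 0 := (Real.sqrt_pos.2 hg).ne'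
      have hs2 : √(x ^ 2 - (n : ℝ) ^ 2) ^ 2 = x ^ 2 - n ^ 2 := Real.sq_sqrt hg.le
      refine ((sqrt_g_hasDerivAt hx).mul (BJ_hasDerivAt n hx0.ne')).congr_deriv ?_
      rw [om]
      generalize √(x ^ 2 - (n : ℝ) ^ 2) = s at *
      rw [← hs2]
      field_simp
      ring)
    (by
      intro x hx
      have hx0 : 0 < x := lt_of_le_of_lt hn hx
      have hg := g_pos hx
      have hs2 : √(x ^ 2 - (n : ℝ) ^ 2) ^ 2 = x ^ 2 - n ^ 2 := Real.sq_sqrt hg.le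
      have hgd : HasDerivAt (fun y : ℝ => (n : ℝ) + y ^ 2 / (2 * (y ^ 2 - n ^ 2)))
          (x / (x ^ 2 - n ^ 2) - x ^ 3 / (x ^ 2 - n ^ 2) ^ 2) x := by
        have h1 := (((hasDerivAt_pow 2 x).div
          (((hasDerivAt_pow 2 x).sub_const ((n : ℝ) ^ 2)).const_mul 2)
          (by positivity)).const_add (n : ℝ))
        refine h1.congr_deriv ?_
        push_cast
        field_simp
      refine (((BJ_hasDerivAt n hx0.ne').mul hgd).sub
        ((hasDerivAt_id x).mul (BJ_hasDerivAt' n hx0.ne'))).congr_deriv ?_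
      simp only [om, rh, id]
      have e : √(x ^ 2 - (n : ℝ) ^ 2) / x * (1 + (x ^ 4 + 4 * n ^ 2 * x ^ 2) / (4 * (x ^ 2 - n ^ 2) ^ 3))
        * (√(x ^ 2 - (n : ℝ) ^ 2) * BJ n x) = √(x ^ 2 - (n : ℝ) ^ 2) ^ 2 / x *
          (1 + (x ^ 4 + 4 * n ^ 2 * x ^ 2) / (4 * (x ^ 2 - n ^ 2) ^ 3)) * BJ n x := by ring
      rw [e, hs2]
      field_simp
      ring)
    (by
      intro x hx
      by_cases h : √(x ^ 2 - n ^ 2) * BJ n x = 0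
      · have := hbne x hx h
        positivity
      · positivity)
    (by
      unfold om
      refine ContinuousOn.div (by fun_prop) (by fun_prop) ?_
      intro x hx; exact (lt_of_le_of_lt hn hx).ne')
    (by
      unfold rh
      refine ContinuousOn.div (by fun_prop) (by fun_prop) ?_
      intro x hx
      have := g_pos hx
      positivity)
  refine ⟨φ, fun x hx => ?_⟩
  obtain ⟨h1, h2⟩ := hφ x hx
  refine ⟨⟨_, by positivity, ?_, h1⟩, h2, ?_⟩
  · apply div_le_one_of_le₀ <;> nlinarith [sq_nonneg (√(x ^ 2 - n ^ 2) * BJ n x), sq_nonneg (BJ n x * (n + x ^ 2 / (2 * (x ^ 2 - n ^ 2))) - x * BJ (n + 1) x)]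
  · have hs : √(x ^ 2 - (n : ℝ) ^ 2) ≠ 0 := (Real.sqrt_pos.2 (g_pos hx)).ne'
    constructor
    · intro h
      have h3 := hbne x hx (by rw [h, mul_zero])
      simp only [h, mul_zero, zero_mul] at h2 h3
      exact (mul_eq_zero.1 h2).resolve_left h3
    · intro h
      have hc : cos (φ x) ≠ 0 := by
        intro hc
        have := sin_sq_add_cos_sq (φ x)
        rw [h, hc] at this; simp at this
      simp only [h, mul_zero] at h2
      have := h2.symm
      simpa [hs, hc] using this


/-- phase function of `J_n` -/
noncomputable def PH (n : ℕ) : ℝ → ℝ := Classical.choose (exists_phase n)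

lemma PH_spec (n : ℕ) : ∀ x, (n : ℝ) < x →
    (∃ q, 0 ≤ q ∧ q ≤ 1 ∧ HasDerivAt (PH n) (om n x * (1 + rh n x * q)) x) ∧
    (BJ n x * (n + x ^ 2 / (2 * (x ^ 2 - n ^ 2))) - x * BJ (n + 1) x) * sin (PH n x) =
      √(x ^ 2 - n ^ 2) * BJ n x * cos (PH n x) ∧
    (BJ n x = 0 ↔ sin (PH n x) = 0) := Classical.choose_spec (exists_phase n)

lemma om_pos {n : ℕ} {x : ℝ} (hx : (n : ℝ) < x) : 0 < om n x :=
  div_pos (Real.sqrt_pos.2 (g_pos hx)) (lt_of_le_of_lt (Nat.cast_nonneg n) hx)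

lemma om_le_one {n : ℕ} {x : ℝ} (hx : (n : ℝ) < x) : om n x ≤ 1 := by
  have hx0 : 0 < x := lt_of_le_of_lt (Nat.cast_nonneg n) hx
  rw [om, div_le_one hx0]
  exact Real.sqrt_le_iff.2 ⟨hx0.le, by nlinarith [sq_nonneg (n : ℝ)]⟩

lemma rh_pos {n : ℕ} {x : ℝ} (hx : (n : ℝ) < x) : 0 ≤ rh n x := by
  have := g_pos hx
  unfold rh; positivity

lemma PH_continuousAt {n : ℕ} {x : ℝ} (hx : (n : ℝ) < x) : ContinuousAt (PH n) x := by
  obtain ⟨⟨q, _, _, h⟩, _⟩ := PH_spec n x hx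
  exact h.continuousAt

lemma PH_strictMono (n : ℕ) : StrictMonoOn (PH n) (Ioi (n : ℝ)) := by
  apply strictMonoOn_of_deriv_pos (convex_Ioi _)
  · intro x hx; exact (PH_continuousAt hx).continuousWithinAt
  · intro x hx
    rw [interior_Ioi] at hx
    obtain ⟨⟨q, h0, _, h⟩, _⟩ := PH_spec n x hx
    rw [h.deriv]
    have := rh_pos hx
    have := om_pos hx
    positivity

/-- phase difference -/
noncomputable def TT (n : ℕ) (x : ℝ) : ℝ := PH n x - SS n x

lemma TT_deriv {n : ℕ} {x : ℝ} (hx : (n : ℝ) < x) :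
    ∃ q, 0 ≤ q ∧ q ≤ 1 ∧ HasDerivAt (TT n) (om n x * rh n x * q) x := by
  obtain ⟨⟨q, h0, h1, h⟩, _⟩ := PH_spec n x hx
  refine ⟨q, h0, h1, (h.sub (SS_hasDerivAt hx)).congr_deriv ?_⟩
  ring

lemma TT_mono (n : ℕ) : MonotoneOn (TT n) (Ioi (n : ℝ)) := by
  apply monotoneOn_of_deriv_nonneg (convex_Ioi _)
  · intro x hx
    obtain ⟨q, _, _, h⟩ := TT_deriv hx
    exact h.continuousAt.continuousWithinAt
  · intro x hx
    rw [interior_Ioi] at hx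
    obtain ⟨q, _, _, h⟩ := TT_deriv hx
    exact h.differentiableAt.differentiableWithinAt
  · intro x hx
    rw [interior_Ioi] at hx
    obtain ⟨q, h0, _, h⟩ := TT_deriv hx
    rw [h.deriv]
    have := rh_pos hx
    have := om_pos hx
    positivity

lemma kappa_mono {n : ℕ} {κ x y : ℝ} (hκ : κ * x ^ 2 ≤ x ^ 2 - n ^ 2)
    (hx : (n : ℝ) < x) (hxy : x ≤ y) : κ * y ^ 2 ≤ y ^ 2 - n ^ 2 := by
  have hx0 : 0 < x := lt_of_le_of_lt (Nat.cast_nonneg n) hx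
  have h1 : κ ≤ 1 - (n : ℝ) ^ 2 / x ^ 2 := by
    rw [le_sub_iff_add_le, ← le_sub_iff_add_le', div_le_iff₀ (by positivity)]; linarith
  have h2 : (n : ℝ) ^ 2 / y ^ 2 ≤ (n : ℝ) ^ 2 / x ^ 2 := by gcongr
  have hy0 : 0 < y := by linarith
  have h3 : κ ≤ 1 - (n : ℝ) ^ 2 / y ^ 2 := by linarith
  calc κ * y ^ 2 ≤ (1 - (n : ℝ) ^ 2 / y ^ 2) * y ^ 2 := by gcongr
    _ = y ^ 2 - n ^ 2 := by field_simp

lemma TT_upper {n : ℕ} {κ x y : ℝ} (hκ0 : 0 < κ) (hκ : κ * x ^ 2 ≤ x ^ 2 - n ^ 2)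
    (hx : (n : ℝ) < x) (hxy : x ≤ y) : TT n y - TT n x ≤ 5 / (4 * κ ^ 3) / x := by
  set C := 5 / (4 * κ ^ 3) with hC
  have hx0 : 0 < x := lt_of_le_of_lt (Nat.cast_nonneg n) hx
  have hCpos : 0 < C := by positivity
  have hd : ∀ t, x ≤ t → ∃ q, q ≤ 0 ∧ HasDerivAt (fun t => TT n t + C * t⁻¹) q t := by
    intro t ht
    have htn : (n : ℝ) < t := by linarith
    have ht0 : 0 < t := by linarith
    obtain ⟨q, h0, h1, h⟩ := TT_deriv htn
    refine ⟨_, ?_, h.add ((hasDerivAt_inv ht0.ne').const_mul C)⟩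
    have hk := kappa_mono hκ hx ht
    have hg := g_pos htn
    have hr : rh n t ≤ C / t ^ 2 := by
      have e1 : t ^ 4 + 4 * n ^ 2 * t ^ 2 ≤ 5 * t ^ 4 := by
        have : (n : ℝ) ^ 2 ≤ t ^ 2 := by linarith
        nlinarith [sq_nonneg t]
      have e2 : 4 * (κ * t ^ 2) ^ 3 ≤ 4 * (t ^ 2 - n ^ 2) ^ 3 := by gcongr
      calc rh n t ≤ (5 * t ^ 4) / (4 * (κ * t ^ 2) ^ 3) := by
            unfold rh
            exact div_le_div₀ (by positivity) e1 (by positivity) e2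
        _ = C / t ^ 2 := by rw [hC]; field_simp
    have hr0 := rh_pos htn
    have ho0 := om_pos htn
    have ho1 := om_le_one htn
    have : om n t * rh n t * q ≤ rh n t := by
      calc om n t * rh n t * q ≤ 1 * rh n t * 1 := by gcongr
        _ = rh n t := by ring
    have e3 : C * -(t ^ 2)⁻¹ = -(C / t ^ 2) := by ring
    rw [e3]; linarith
  have hanti : AntitoneOn (fun t => TT n t + C * t⁻¹) (Ici x) := by
    apply antitoneOn_of_deriv_nonpos (convex_Ici _)
    · intro t ht
      obtain ⟨q, _, h⟩ := hd t ht
      exact h.continuousAt.continuousWithinAt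
    · intro t ht
      rw [interior_Ici] at ht
      obtain ⟨q, _, h⟩ := hd t (le_of_lt ht)
      exact h.differentiableAt.differentiableWithinAt
    · intro t ht
      rw [interior_Ici] at ht
      obtain ⟨q, h0, h⟩ := hd t (le_of_lt ht)
      rw [h.deriv]; exact h0
  have := hanti (mem_Ici.2 le_rfl) (mem_Ici.2 hxy) hxy
  simp only at this
  have hy0 : 0 < y := by linarith
  have : 0 < C * y⁻¹ := by positivity
  rw [div_eq_mul_inv]
  linarith

lemma exists_kappa {n : ℕ} {x : ℝ} (hx : (n : ℝ) < x) :
    ∃ κ : ℝ, 0 < κ ∧ κ * x ^ 2 ≤ x ^ 2 - n ^ 2 := by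
  have hx0 : 0 < x := lt_of_le_of_lt (Nat.cast_nonneg n) hx
  have := g_pos hx
  exact ⟨(x ^ 2 - n ^ 2) / x ^ 2, by positivity, by field_simp; rfl⟩

lemma TT_tendsto (n : ℕ) : ∃ L, Tendsto (TT n) atTop (nhds L) ∧
    ∀ x κ, (n : ℝ) < x → 0 < κ → κ * x ^ 2 ≤ x ^ 2 - n ^ 2 →
      TT n x ≤ L ∧ L ≤ TT n x + 5 / (4 * κ ^ 3) / x := by
  have hn1 : (n : ℝ) < n + 1 := by linarith
  obtain ⟨κ0, hκ0, hκ1⟩ := exists_kappa hn1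
  set F : ℝ → ℝ := fun x => TT n (max x (n + 1)) with hF
  have hm : Monotone F := by
    intro x y hxy
    apply TT_mono n
    · exact lt_of_lt_of_le hn1 (le_max_right _ _)
    · exact lt_of_lt_of_le hn1 (le_max_right _ _)
    · exact max_le_max hxy le_rfl
  have hbdd : BddAbove (range F) := by
    refine ⟨TT n (n + 1) + 5 / (4 * κ0 ^ 3) / (n + 1), ?_⟩
    rintro _ ⟨x, rfl⟩
    have := TT_upper hκ0 hκ1 hn1 (le_max_right x _)
    simp only [hF]; linarith
  have ht := tendsto_atTop_ciSup hm hbdd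
  have ht' : Tendsto (TT n) atTop (nhds (⨆ i, F i)) := by
    refine ht.congr' ?_
    filter_upwards [eventually_ge_atTop ((n : ℝ) + 1)] with x hx
    simp [hF, max_eq_left hx]
  refine ⟨_, ht', ?_⟩
  intro x κ hx hκ hκ'
  constructor
  · apply ge_of_tendsto ht'
    filter_upwards [eventually_ge_atTop x] with y hy
    exact TT_mono n hx (lt_of_lt_of_le hx hy) hy
  · apply le_of_tendsto ht'
    filter_upwards [eventually_ge_atTop x] with y hy
    have := TT_upper hκ hκ' hx hy
    linarith

lemma SS_sub_tendsto (n : ℕ) : Tendsto (fun x => SS n x - x) atTop (nhds (-(n * (π / 2)))) := by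
  have h1 : Tendsto (fun x : ℝ => (n : ℝ) / x) atTop (nhds 0) :=
    tendsto_const_nhds.div_atTop tendsto_id
  have h2 : Tendsto (fun x : ℝ => arccos ((n : ℝ) / x)) atTop (nhds (π / 2)) := by
    have := (Real.continuous_arccos.tendsto 0).comp h1
    rwa [Real.arccos_zero] at this
  have h3 : Tendsto (fun x : ℝ => √(x ^ 2 - n ^ 2) - x) atTop (nhds 0) := by
    have h4 : Tendsto (fun x : ℝ => -((n : ℝ) ^ 2 / x)) atTop (nhds 0) := by
      have : Tendsto (fun x : ℝ => (n : ℝ) ^ 2 / x) atTop (nhds 0) :=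
        tendsto_const_nhds.div_atTop tendsto_id
      simpa using this.neg
    refine tendsto_of_tendsto_of_tendsto_of_le_of_le' h4 tendsto_const_nhds ?_ ?_
    · filter_upwards [eventually_gt_atTop (n : ℝ)] with x hx
      have hx0 : 0 < x := lt_of_le_of_lt (Nat.cast_nonneg n) hx
      have hg := g_pos hx
      have hle : x - (n : ℝ) ^ 2 / x ≤ √(x ^ 2 - n ^ 2) := by
        apply Real.le_sqrt_of_sq_le
        have e : (x - (n : ℝ) ^ 2 / x) ^ 2 = (x ^ 2 - n ^ 2) * ((x ^ 2 - n ^ 2) / x ^ 2) := by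
          field_simp
        rw [e]
        have : (x ^ 2 - (n : ℝ) ^ 2) / x ^ 2 ≤ 1 := by
          rw [div_le_one (by positivity)]; nlinarith [sq_nonneg (n : ℝ)]
        nlinarith
      linarith
    · filter_upwards [eventually_gt_atTop (n : ℝ)] with x hx
      have hx0 : 0 < x := lt_of_le_of_lt (Nat.cast_nonneg n) hx
      have : √(x ^ 2 - n ^ 2) ≤ x := Real.sqrt_le_iff.2 ⟨hx0.le, by nlinarith [sq_nonneg (n : ℝ)]⟩
      linarith
  have h5 := h3.sub (h2.const_mul (n : ℝ))
  rw [zero_sub] at h5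
  refine h5.congr ?_
  intro x; simp only [SS]; ring

lemma PH_sub_tendsto (n : ℕ) : ∃ L, Tendsto (TT n) atTop (nhds L) ∧
    Tendsto (fun x => PH n x - x) atTop (nhds (L - n * (π / 2))) := by
  obtain ⟨L, hL, _⟩ := TT_tendsto n
  refine ⟨L, hL, ?_⟩
  have := hL.add (SS_sub_tendsto n)
  rw [← sub_eq_add_neg] at this
  refine this.congr ?_
  intro x; simp only [TT]; ring

lemma PH_tendsto_atTop (n : ℕ) : Tendsto (PH n) atTop atTop := by
  obtain ⟨L, _, h⟩ := PH_sub_tendsto n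
  have := h.add_atTop tendsto_id
  refine this.congr ?_
  intro x; simp

/-- `z` enumerates the positive zeros of `J_n` from index one. -/
structure ZE (n : ℕ) (z : ℕ → ℝ) : Prop where
  pos : ∀ k, 1 ≤ k → 0 < z k
  mono : ∀ k l, 1 ≤ k → k < l → z k < z l
  zero : ∀ k, 1 ≤ k → BJ n (z k) = 0
  all : ∀ x, 0 < x → BJ n x = 0 → ∃ k, 1 ≤ k ∧ z k = x

lemma ZE.lt_imp {n : ℕ} {z : ℕ → ℝ} (h : ZE n z) {k l : ℕ} (hl : 1 ≤ l) (hkl : z k < z l) :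
    k < l ∨ k = 0 := by
  rcases Nat.eq_zero_or_pos k with h0 | h0
  · right; exact h0
  left
  by_contra hcon
  push Not at hcon
  rcases hcon.lt_or_eq with h1 | h1
  · have := h.mono l k hl h1; linarith
  · rw [h1] at hkl; exact lt_irrefl _ hkl

lemma ZE.mono_le {n : ℕ} {z : ℕ → ℝ} (h : ZE n z) {k l : ℕ} (hk : 1 ≤ k) (hkl : k ≤ l) :
    z k ≤ z l := by
  rcases hkl.lt_or_eq with h1 | h1
  · exact (h.mono k l hk h1).le
  · rw [h1]

/-- no zero strictly between consecutive ones -/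
lemma ZE.gap {n : ℕ} {z : ℕ → ℝ} (h : ZE n z) {k : ℕ} (hk : 1 ≤ k) {x : ℝ}
    (h1 : z k < x) (h2 : x < z (k + 1)) : BJ n x ≠ 0 := by
  intro h0
  obtain ⟨m, hm, rfl⟩ := h.all x ((h.pos k hk).trans h1) h0
  have a1 := h.lt_imp hm h1
  have a2 := h.lt_imp (by omega) h2
  omega

lemma ZE.step {n : ℕ} {z : ℕ → ℝ} (h : ZE n z) {k : ℕ} (hk : 1 ≤ k) (hkn : (n : ℝ) < z k) :
    PH n (z (k + 1)) = PH n (z k) + π := by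
  have hlt := h.mono k (k + 1) hk (by omega)
  have hkn' : (n : ℝ) < z (k + 1) := hkn.trans hlt
  have hs1 := (PH_spec n _ hkn).2.2.1 (h.zero k hk)
  have hs2 := (PH_spec n _ hkn').2.2.1 (h.zero (k + 1) (by omega))
  obtain ⟨a, ha⟩ := Real.sin_eq_zero_iff.1 hs1
  obtain ⟨b, hb⟩ := Real.sin_eq_zero_iff.1 hs2
  have hP := PH_strictMono n hkn hkn' hlt
  rw [← ha, ← hb] at hP ⊢
  have hab : a < b := by
    have := lt_of_mul_lt_mul_right hP Real.pi_pos.le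
    exact_mod_cast this
  rcases (Int.add_one_le_iff.2 hab).eq_or_lt with h1 | h1
  · rw [← h1]; push_cast; ring
  · exfalso
    have hcont : ContinuousOn (PH n) (Icc (z k) (z (k + 1))) := fun x hx =>
      (PH_continuousAt (lt_of_lt_of_le hkn hx.1)).continuousWithinAt
    have hmem : ((a + 1 : ℤ) : ℝ) * π ∈ Ioo (PH n (z k)) (PH n (z (k + 1))) := by
      rw [← ha, ← hb]
      constructor
      · push_cast; linarith [Real.pi_pos]
      · apply mul_lt_mul_of_pos_right _ Real.pi_pos
        exact_mod_cast h1
    obtain ⟨x, hx, hxe⟩ := intermediate_value_Ioo hlt.le hcont hmem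
    apply h.gap hk hx.1 hx.2
    apply (PH_spec n x (hkn.trans hx.1)).2.2.2
    rw [hxe]; exact Real.sin_int_mul_pi _

lemma ZE.steps {n : ℕ} {z : ℕ → ℝ} (h : ZE n z) {k : ℕ} (hk : 1 ≤ k) (hkn : (n : ℝ) < z k)
    (m : ℕ) : PH n (z (k + m)) = PH n (z k) + m * π := by
  induction m with
  | zero => simp
  | succ m ih =>
    have : (n : ℝ) < z (k + m) := lt_of_lt_of_le hkn (h.mono_le hk (by omega))
    rw [← add_assoc, h.step (by omega) this, ih]; push_cast; ring

lemma ZE.exists_large {n : ℕ} {z : ℕ → ℝ} (h : ZE n z) : ∃ k, 1 ≤ k ∧ (n : ℝ) < z k := by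
  -- find a zero beyond n + 1
  set x0 : ℝ := n + 1
  have hx0 : (n : ℝ) < x0 := by simp [x0]
  obtain ⟨a, ha⟩ := exists_int_gt (PH n x0 / π)
  rw [div_lt_iff₀ Real.pi_pos] at ha
  obtain ⟨y, hy, hy2⟩ := ((PH_tendsto_atTop n).eventually_gt_atTop ((a : ℝ) * π)).and
    (eventually_gt_atTop x0) |>.exists
  have hcont : ContinuousOn (PH n) (Icc x0 y) := fun x hx =>
      (PH_continuousAt (lt_of_lt_of_le hx0 hx.1)).continuousWithinAt
  obtain ⟨x, hx, hxe⟩ := intermediate_value_Ioo hy2.le hcont ⟨ha, hy⟩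
  have hxn : (n : ℝ) < x := hx0.trans hx.1
  have : BJ n x = 0 := by
    apply (PH_spec n x hxn).2.2.2
    rw [hxe]; exact Real.sin_int_mul_pi _
  obtain ⟨k, hk, rfl⟩ := h.all x (lt_of_le_of_lt (Nat.cast_nonneg n) hxn) this
  exact ⟨k, hk, hxn⟩

lemma ZE.tendsto {n : ℕ} {z : ℕ → ℝ} (h : ZE n z) : Tendsto z atTop atTop := by
  obtain ⟨k, hk, hkn⟩ := h.exists_large
  rw [tendsto_atTop]
  intro X
  set Y := max X (n + 1) with hY
  have hYn : (n : ℝ) < Y := lt_of_lt_of_le (by linarith) (le_max_right _ _)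
  obtain ⟨m, hm⟩ := exists_nat_gt ((PH n Y - PH n (z k)) / π)
  rw [div_lt_iff₀ Real.pi_pos] at hm
  have h1 := h.steps hk hkn m
  have hz : (n : ℝ) < z (k + m) := lt_of_lt_of_le hkn (h.mono_le hk (by omega))
  have h2 : Y < z (k + m) := by
    by_contra hcon
    push Not at hcon
    have := (PH_strictMono n).monotoneOn hz hYn hcon
    linarith
  filter_upwards [eventually_ge_atTop (k + m)] with j hj
  have := h.mono_le (show 1 ≤ k + m by omega) hj
  linarith [le_max_left X ((n : ℝ) + 1)]

lemma ZE.lim {n : ℕ} {z : ℕ → ℝ} (h : ZE n z) :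
    ∃ c, Tendsto (fun m => z m - m * π) atTop (nhds c) ∧
    ∀ k κ, 1 ≤ k → (n : ℝ) < z k → 0 < κ → κ * z k ^ 2 ≤ z k ^ 2 - n ^ 2 →
      c - n * (π / 2) ≤ SS n (z k) - k * π ∧
      SS n (z k) - k * π - 5 / (4 * κ ^ 3) / z k ≤ c - n * (π / 2) := by
  obtain ⟨L, hL, hL2⟩ := TT_tendsto n
  have hPl : Tendsto (fun x => PH n x - x) atTop (nhds (L - n * (π / 2))) := by
    have := hL.add (SS_sub_tendsto n)
    rw [← sub_eq_add_neg] at this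
    refine this.congr ?_
    intro x; simp only [TT]; ring
  have hlim : ∀ k, 1 ≤ k → (n : ℝ) < z k → Tendsto (fun m => z m - m * π) atTop
      (nhds (PH n (z k) - k * π - (L - n * (π / 2)))) := by
    intro k hk hkn
    rw [← tendsto_add_atTop_iff_nat k]
    have h1 := (hPl.comp h.tendsto).comp (tendsto_add_atTop_nat k)
    have h2 := (tendsto_const_nhds (x := PH n (z k) - k * π)).sub h1
    refine h2.congr ?_
    intro m
    simp only [Function.comp]
    rw [add_comm m k, h.steps hk hkn m]
    push_cast; ring
  obtain ⟨k0, hk0, hk0n⟩ := h.exists_large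
  refine ⟨_, hlim k0 hk0 hk0n, ?_⟩
  intro k κ hk hkn hκ hκ'
  rw [tendsto_nhds_unique (hlim k0 hk0 hk0n) (hlim k hk hkn)]
  obtain ⟨h1, h2⟩ := hL2 (z k) κ hkn hκ hκ'
  simp only [TT] at h1 h2
  constructor <;> linarith


lemma rolle_up (n : ℕ) {a b : ℝ} (ha : 0 ≤ a) (hab : a < b) (h0 : a = 0 ∨ BJ (n + 1) a = 0)
    (h1 : BJ (n + 1) b = 0) : ∃ c ∈ Ioo a b, BJ n c = 0 := by
  obtain ⟨c, hc, hc2⟩ := exists_hasDerivAt_eq_zero (f := fun x => x ^ (n + 1) * BJ (n + 1) x)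
    (f' := fun x => x ^ (n + 1) * BJ n x) hab
    ((continuous_pow _).mul (BJ_continuous _)).continuousOn
    (by
      rcases h0 with h0 | h0
      · simp [h0, h1]
      · simp [h0, h1])
    (by
      intro x hx
      have hx0 : 0 < x := lt_of_le_of_lt ha hx.1
      refine ((hasDerivAt_pow (n + 1) x).mul (BJ_hasDerivAt' n hx0.ne')).congr_deriv ?_
      rw [Nat.add_sub_cancel]; push_cast
      field_simp
      ring)
  refine ⟨c, hc, ?_⟩
  have hc0 : 0 < c := lt_of_le_of_lt ha hc.1
  simpa [hc0.ne'] using hc2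

lemma rolle_down (n : ℕ) {a b : ℝ} (ha : 0 < a) (hab : a < b) (h0 : BJ n a = 0)
    (h1 : BJ n b = 0) : ∃ c ∈ Ioo a b, BJ (n + 1) c = 0 := by
  have hd : ∀ x : ℝ, 0 < x → HasDerivAt (fun x => BJ n x / x ^ n) (-(BJ (n + 1) x / x ^ n)) x := by
    intro x hx
    refine ((BJ_hasDerivAt n hx.ne').div (hasDerivAt_pow n x) (by positivity)).congr_deriv ?_
    cases n with
    | zero => simp
    | succ k =>
      rw [Nat.add_sub_cancel]; push_cast
      field_simp
      ring
  obtain ⟨c, hc, hc2⟩ := exists_hasDerivAt_eq_zero (f := fun x => BJ n x / x ^ n)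
    (f' := fun x => -(BJ (n + 1) x / x ^ n)) hab
    (fun x hx => (hd x (lt_of_lt_of_le ha hx.1)).continuousAt.continuousWithinAt)
    (by simp [h0, h1])
    (fun x hx => hd x (ha.trans hx.1))
  refine ⟨c, hc, ?_⟩
  have hc0 : 0 < c := ha.trans hc.1
  simpa [hc0.ne'] using hc2

lemma interlace1 {n : ℕ} {z y : ℕ → ℝ} (hz : ZE n z) (hy : ZE (n + 1) y) (k : ℕ) (hk : 1 ≤ k) :
    z k < y k := by
  induction k, hk using Nat.le_induction with
  | base =>
    obtain ⟨c, hc, hc2⟩ := rolle_up n le_rfl (hy.pos 1 le_rfl) (Or.inl rfl) (hy.zero 1 le_rfl)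
    obtain ⟨m, hm, rfl⟩ := hz.all c hc.1 hc2
    exact lt_of_le_of_lt (hz.mono_le le_rfl hm) hc.2
  | succ k hk ih =>
    obtain ⟨c, hc, hc2⟩ := rolle_up n (hy.pos k hk).le (hy.mono k (k + 1) hk (by omega))
      (Or.inr (hy.zero k hk)) (hy.zero (k + 1) (by omega))
    obtain ⟨m, hm, rfl⟩ := hz.all c ((hy.pos k hk).trans hc.1) hc2
    have := hz.lt_imp hm (ih.trans hc.1)
    exact lt_of_le_of_lt (hz.mono_le (by omega) (show k + 1 ≤ m by omega)) hc.2

lemma interlace2 {n : ℕ} {z y : ℕ → ℝ} (hz : ZE n z) (hy : ZE (n + 1) y) (k : ℕ) (hk : 1 ≤ k) :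
    y k < z (k + 1) := by
  induction k, hk using Nat.le_induction with
  | base =>
    obtain ⟨c, hc, hc2⟩ := rolle_down n (hz.pos 1 le_rfl) (hz.mono 1 2 le_rfl (by omega))
      (hz.zero 1 le_rfl) (hz.zero 2 (by omega))
    obtain ⟨m, hm, rfl⟩ := hy.all c ((hz.pos 1 le_rfl).trans hc.1) hc2
    exact lt_of_le_of_lt (hy.mono_le le_rfl hm) hc.2
  | succ k hk ih =>
    obtain ⟨c, hc, hc2⟩ := rolle_down n (hz.pos (k + 1) (by omega))
      (hz.mono (k + 1) (k + 1 + 1) (by omega) (by omega))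
      (hz.zero (k + 1) (by omega)) (hz.zero (k + 1 + 1) (by omega))
    obtain ⟨m, hm, rfl⟩ := hy.all c ((hz.pos (k + 1) (by omega)).trans hc.1) hc2
    have := hy.lt_imp hm (ih.trans hc.1)
    exact lt_of_le_of_lt (hy.mono_le (by omega) (show k + 1 ≤ m by omega)) hc.2

lemma cot_tendsto (n : ℕ) : Tendsto (fun x : ℝ => (n + x ^ 2 / (2 * (x ^ 2 - n ^ 2))) /
    √(x ^ 2 - n ^ 2)) atTop (nhds 0) := by
  have hg : Tendsto (fun x : ℝ => x ^ 2 - (n : ℝ) ^ 2) atTop atTop :=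
    tendsto_atTop_add_const_right _ _ (tendsto_pow_atTop two_ne_zero)
  have hs : Tendsto (fun x : ℝ => √(x ^ 2 - (n : ℝ) ^ 2)) atTop atTop :=
    Real.tendsto_sqrt_atTop.comp hg
  have h1 : Tendsto (fun x : ℝ => (n : ℝ) + (1 / 2 + ((n : ℝ) ^ 2 / 2) / (x ^ 2 - n ^ 2))) atTop
      (nhds ((n:ℝ) + (1 / 2 + 0))) :=
    (tendsto_const_nhds.add ((tendsto_const_nhds.div_atTop hg).const_add _))
  refine (h1.div_atTop hs).congr' ?_
  filter_upwards [eventually_gt_atTop (n : ℝ)] with x hx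
  have := g_pos hx
  congr 2
  field_simp
  ring

lemma ZE.next {n : ℕ} {z y : ℕ → ℝ} (hz : ZE n z) (hy : ZE (n + 1) y) :
    Tendsto (fun k => y k - z k) atTop (nhds (π / 2)) := by
  obtain ⟨L, _, hP⟩ := PH_sub_tendsto n
  have hD : Tendsto (fun k => PH n (y k) - PH n (z k)) atTop (nhds (π / 2)) := by
    have h1 := (Real.continuous_arctan.tendsto 0).comp ((cot_tendsto n).comp hy.tendsto)
    rw [Real.arctan_zero] at h1
    have h2 := (tendsto_const_nhds (x := π / 2)).sub h1
    rw [sub_zero] at h2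
    refine h2.congr' ?_
    filter_upwards [eventually_ge_atTop 1, hz.tendsto.eventually_gt_atTop (n : ℝ)] with k hk hkn
    have i1 := interlace1 hz hy k hk
    have i2 := interlace2 hz hy k hk
    have hyn : (n : ℝ) < y k := hkn.trans i1
    have hzn1 : (n : ℝ) < z (k + 1) := hyn.trans i2
    have p1 := PH_strictMono n hkn hyn i1
    have p2 := PH_strictMono n hyn hzn1 i2
    rw [hz.step hk hkn] at p2
    obtain ⟨a, ha⟩ := Real.sin_eq_zero_iff.1 ((PH_spec n _ hkn).2.2.1 (hz.zero k hk))
    have hBne : BJ n (y k) ≠ 0 := hz.gap hk i1 i2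
    have hs := (PH_spec n _ hyn).2.1
    rw [hy.zero k hk] at hs
    set D := PH n (y k) - PH n (z k) with hDdef
    have e1 : PH n (y k) = D + a * π := by rw [ha, hDdef]; ring
    rw [e1, Real.sin_add_int_mul_pi, Real.cos_add_int_mul_pi] at hs
    have hne : ((-1 : ℝ) ^ a) ≠ 0 := zpow_ne_zero _ (by norm_num)
    have hsin : 0 < sin D := Real.sin_pos_of_pos_of_lt_pi (by linarith) (by linarith)
    have hg := Real.sqrt_pos.2 (g_pos hyn)
    have hs' : (n + y k ^ 2 / (2 * (y k ^ 2 - n ^ 2))) * sin D = √(y k ^ 2 - n ^ 2) * cos D := by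
      have : BJ n (y k) * (-1 : ℝ) ^ a * ((n + y k ^ 2 / (2 * (y k ^ 2 - n ^ 2))) * sin D)
        = BJ n (y k) * (-1 : ℝ) ^ a * (√(y k ^ 2 - n ^ 2) * cos D) := by linarith
      exact mul_left_cancel₀ (mul_ne_zero hBne hne) this
    have hcot : (n + y k ^ 2 / (2 * (y k ^ 2 - n ^ 2))) / √(y k ^ 2 - n ^ 2) = tan (π / 2 - D) := by
      rw [Real.tan_pi_div_two_sub, Real.tan_eq_sin_div_cos, inv_div, div_eq_div_iff hg.ne' hsin.ne']
      linarith
    simp only [Function.comp]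
    rw [hcot, Real.arctan_tan (by linarith) (by linarith)]
    ring
  have h3 := hD.sub ((hP.comp hy.tendsto).sub (hP.comp hz.tendsto))
  rw [sub_self, sub_zero] at h3
  refine h3.congr ?_
  intro k
  simp only [Function.comp]
  ring


/-! ### Asymptotics of `J_0` at infinity -/

noncomputable def v0 (x : ℝ) : ℝ := √x * BJ 0 x
noncomputable def w0 (x : ℝ) : ℝ := BJ 0 x / (2 * √x) - √x * BJ 1 x

lemma v0_hasDerivAt {x : ℝ} (hx : 0 < x) : HasDerivAt v0 (w0 x) x := by
  have hs := (Real.sqrt_pos.2 hx).ne'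
  refine ((Real.hasDerivAt_sqrt hx.ne').mul (BJ0_hasDerivAt x)).congr_deriv ?_
  rw [w0]
  field_simp
  ring

lemma w0_hasDerivAt {x : ℝ} (hx : 0 < x) : HasDerivAt w0 (-((1 + 1 / (4 * x ^ 2)) * v0 x)) x := by
  have hs := (Real.sqrt_pos.2 hx).ne'
  have hs2 := Real.sq_sqrt hx.le
  have h1 := (BJ0_hasDerivAt x).div ((Real.hasDerivAt_sqrt hx.ne').const_mul 2)
    (mul_ne_zero two_ne_zero hs)
  have h2 := (Real.hasDerivAt_sqrt hx.ne').mul (BJ_hasDerivAt' 0 hx.ne')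
  refine (h1.sub h2).congr_deriv ?_
  simp only [zero_add, Nat.cast_zero]
  rw [v0]
  generalize √x = s at *
  rw [← hs2]
  field_simp
  ring

lemma R0_bound : ∃ K : ℝ, 0 ≤ K ∧ ∀ x, 1 ≤ x → |v0 x| ≤ K := by
  set F : ℝ → ℝ := fun x => (v0 x ^ 2 + w0 x ^ 2) * exp (1 / 4 * x⁻¹) with hF
  have hd : ∀ x, 1 ≤ x → ∃ q, q ≤ 0 ∧ HasDerivAt F q x := by
    intro x hx
    have hx0 : 0 < x := by linarith
    have h1 := (((v0_hasDerivAt hx0).pow 2).add ((w0_hasDerivAt hx0).pow 2)).mul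
      (((hasDerivAt_inv hx0.ne').const_mul (1 / 4 : ℝ)).exp)
    refine ⟨_, ?_, h1⟩
    simp only [Pi.add_apply, Pi.pow_apply]
    have e : (2 * v0 x ^ (2 - 1) * w0 x + 2 * w0 x ^ (2 - 1) * -((1 + 1 / (4 * x ^ 2)) * v0 x)) *
        exp (1 / 4 * x⁻¹) + (v0 x ^ 2 + w0 x ^ 2) * (exp (1 / 4 * x⁻¹) * (1 / 4 * -(x ^ 2)⁻¹))
        = -(exp (1 / 4 * x⁻¹) * (v0 x + w0 x) ^ 2 / (4 * x ^ 2)) := by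
      simp only [Nat.add_one_sub_one, pow_one]
      field_simp
      ring
    push_cast
    rw [e]
    have : 0 ≤ exp (1 / 4 * x⁻¹) * (v0 x + w0 x) ^ 2 / (4 * x ^ 2) := by positivity
    linarith
  have hanti : AntitoneOn F (Ici 1) := by
    apply antitoneOn_of_deriv_nonpos (convex_Ici _)
    · intro t ht
      obtain ⟨q, _, h⟩ := hd t ht
      exact h.continuousAt.continuousWithinAt
    · intro t ht
      rw [interior_Ici] at ht
      obtain ⟨q, _, h⟩ := hd t (le_of_lt ht)
      exact h.differentiableAt.differentiableWithinAt
    · intro t ht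
      rw [interior_Ici] at ht
      obtain ⟨q, h0, h⟩ := hd t (le_of_lt ht)
      rw [h.deriv]; exact h0
  refine ⟨√(F 1), Real.sqrt_nonneg _, ?_⟩
  intro x hx
  apply Real.abs_le_sqrt
  have h1 := hanti (mem_Ici.2 le_rfl) (mem_Ici.2 hx) hx
  have h2 : 1 ≤ exp (1 / 4 * x⁻¹) := by
    apply Real.one_le_exp
    have : 0 < x := by linarith
    positivity
  refine le_trans ?_ h1
  simp only [hF]
  nlinarith [sq_nonneg (v0 x), sq_nonneg (w0 x)]

noncomputable def z0 (x : ℝ) : ℂ := ((w0 x : ℂ) + Complex.I * (v0 x : ℂ)) * Complex.exp (-(Complex.I * x))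

lemma z0_hasDerivAt {x : ℝ} (hx : 0 < x) :
    HasDerivAt z0 (-((v0 x / (4 * x ^ 2) : ℝ) : ℂ) * Complex.exp (-(Complex.I * x))) x := by
  have h1 := (w0_hasDerivAt hx).ofReal_comp
  have h2 := ((v0_hasDerivAt hx).ofReal_comp).const_mul Complex.I
  have h3 : HasDerivAt (fun y : ℝ => -(Complex.I * (y : ℂ))) (-(Complex.I * 1)) x :=
    (((hasDerivAt_id x).ofReal_comp).const_mul Complex.I).neg
  refine ((h1.add h2).mul h3.cexp).congr_deriv ?_
  have hI : Complex.I ^ 2 = -1 := Complex.I_sq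
  have hxc : (x : ℂ) ≠ 0 := by exact_mod_cast hx.ne'
  simp only [Pi.add_apply]
  push_cast
  field_simp
  ring_nf
  rw [hI]
  ring

lemma z0_diff : ∃ C : ℝ, 0 ≤ C ∧ ∀ x y, 1 ≤ x → x ≤ y → ‖z0 y - z0 x‖ ≤ C / x := by
  obtain ⟨K, hK, hv⟩ := R0_bound
  refine ⟨K, hK, ?_⟩
  intro x y hx hxy
  have hx0 : 0 < x := by linarith
  have hnorm : ∀ t : ℝ, ‖Complex.exp (-(Complex.I * t))‖ = 1 := by
    intro t
    rw [Complex.norm_exp]; simp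
  have key := image_norm_le_of_norm_deriv_right_le_deriv_boundary' (f := fun t => z0 t - z0 x)
    (f' := fun t => -((v0 t / (4 * t ^ 2) : ℝ) : ℂ) * Complex.exp (-(Complex.I * t)))
    (a := x) (b := y) (B := fun t => K / x - K * t⁻¹) (B' := fun t => - (K * -(t ^ 2)⁻¹))
    (fun t ht => ((z0_hasDerivAt (lt_of_lt_of_le hx0 ht.1)).sub_const _).continuousAt.continuousWithinAt)
    (fun t ht => ((z0_hasDerivAt (lt_of_lt_of_le hx0 ht.1)).sub_const _).hasDerivWithinAt)
    (by simp [div_eq_mul_inv])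
    (fun t ht => ((((hasDerivAt_inv (lt_of_lt_of_le hx0 ht.1).ne').const_mul K).const_sub (K / x))).continuousAt.continuousWithinAt)
    (fun t ht => ((((hasDerivAt_inv (lt_of_lt_of_le hx0 ht.1).ne').const_mul K).const_sub (K / x))).hasDerivWithinAt)
    (by
      intro t ht
      have ht0 : 0 < t := lt_of_lt_of_le hx0 ht.1
      rw [norm_mul, hnorm, mul_one, norm_neg, Complex.norm_real, Real.norm_eq_abs, abs_div,
        abs_of_pos (show 0 < 4 * t ^ 2 by positivity)]
      have := hv t (hx.trans ht.1)
      calc |v0 t| / (4 * t ^ 2) ≤ K / (4 * t ^ 2) := by gcongr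
        _ ≤ K / t ^ 2 := by gcongr; nlinarith
        _ = -(K * -(t ^ 2)⁻¹) := by ring)
    (show y ∈ Icc x y from ⟨hxy, le_rfl⟩)
  refine key.trans ?_
  have : 0 ≤ K * y⁻¹ := by
    have : 0 < y := by linarith
    positivity
  linarith

lemma J0_asymp : ∃ (Z : ℂ) (C : ℝ), 0 ≤ C ∧
    ∀ x : ℝ, 1 ≤ x → |v0 x - (Z * Complex.exp (Complex.I * x)).im| ≤ C / x := by
  obtain ⟨C, hC, hz⟩ := z0_diff
  have hcau : CauchySeq (fun t : ℝ => z0 (max t 1)) := by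
    refine cauchySeq_of_le_tendsto_0 (fun N : ℝ => C / max N 1) ?_ ?_
    · intro n m N hn hm
      have key : ∀ a b : ℝ, N ≤ a → N ≤ b → a ≤ b →
          dist (z0 (max a 1)) (z0 (max b 1)) ≤ C / max N 1 := by
        intro a b ha hb hab
        rw [dist_comm, dist_eq_norm]
        refine (hz _ _ (le_max_right _ _) (max_le_max hab le_rfl)).trans ?_
        have : 0 < max N 1 := lt_of_lt_of_le one_pos (le_max_right _ _)
        gcongr
      rcases le_total n m with h | h
      · exact key n m hn hm h
      · rw [dist_comm]; exact key m n hm hn h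
    · refine tendsto_const_nhds.div_atTop ?_
      exact tendsto_atTop_mono (fun x => le_max_left x 1) tendsto_id
  obtain ⟨Z, hZ⟩ := cauchySeq_tendsto_of_complete hcau
  refine ⟨Z, C, hC, ?_⟩
  intro x hx
  have hle : ‖Z - z0 x‖ ≤ C / x := by
    apply le_of_tendsto ((hZ.sub_const (z0 x)).norm)
    filter_upwards [eventually_ge_atTop x] with y hy
    rw [max_eq_left (hx.trans hy)]
    exact hz x y hx hy
  have e : v0 x = (z0 x * Complex.exp (Complex.I * x)).im := by
    rw [z0, mul_assoc, ← Complex.exp_add]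
    simp
  rw [e, ← Complex.sub_im, ← sub_mul]
  refine (Complex.abs_im_le_norm _).trans ?_
  rw [norm_mul, norm_sub_rev]
  have : ‖Complex.exp (Complex.I * x)‖ = 1 := by rw [Complex.norm_exp]; simp
  rw [this, mul_one]; exact hle


noncomputable def EE (e x : ℝ) : ℂ := Complex.exp (-((e + Complex.I) * x))

lemma EE_norm (e x : ℝ) : ‖EE e x‖ = rexp (-(e * x)) := by
  rw [EE, Complex.norm_exp]; simp

lemma EE_cont (e : ℝ) : Continuous (EE e) := by unfold EE; fun_prop

lemma EE_hasDerivAt_x (e x : ℝ) : HasDerivAt (EE e) (-(e + Complex.I) * EE e x) x := by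
  have h1 : HasDerivAt (fun x : ℝ => (x : ℂ)) 1 x := Complex.ofRealCLM.hasDerivAt
  have := ((h1.const_mul ((e : ℂ) + Complex.I)).neg).cexp
  refine this.congr_deriv ?_
  simp [EE]; ring

lemma EE_hasDerivAt_e (e x : ℝ) : HasDerivAt (fun e => EE e x) (-(x : ℂ) * EE e x) e := by
  have h1 : HasDerivAt (fun x : ℝ => (x : ℂ)) 1 e := Complex.ofRealCLM.hasDerivAt
  have := (((h1.add_const Complex.I).mul_const (x : ℂ)).neg).cexp
  refine this.congr_deriv ?_
  simp [EE]; ring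

lemma xexp_integrable {e : ℝ} (he : 0 < e) : MeasureTheory.IntegrableOn (fun x : ℝ => x * rexp (-(e * x))) (Ioi 0) := by
  have := integrableOn_rpow_mul_exp_neg_mul_rpow (p := 1) (s := 1) (b := e) (by norm_num) (by norm_num) he
  simpa using this

lemma exp_integrable {e : ℝ} (he : 0 < e) (c : ℝ) : MeasureTheory.IntegrableOn (fun x : ℝ => rexp (-(e * x))) (Ioi c) := by
  have := integrableOn_exp_mul_Ioi (a := -e) (by linarith) c
  simpa using this

lemma EE_int {e : ℝ} (he : 0 < e) {g : ℝ → ℝ} (hg : Continuous g) (hb : ∀ x, 0 ≤ x → |g x| ≤ 1) :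
    MeasureTheory.IntegrableOn (fun x => EE e x * (g x : ℂ)) (Ioi 0) := by
  refine MeasureTheory.Integrable.mono' (exp_integrable he 0) ?_ ?_
  · exact ((EE_cont e).mul (Complex.continuous_ofReal.comp hg)).aestronglyMeasurable
  · refine (MeasureTheory.ae_restrict_mem measurableSet_Ioi).mono fun x hx => ?_
    rw [norm_mul, EE_norm, Complex.norm_real]
    exact mul_le_of_le_one_right (exp_pos _).le (hb x (le_of_lt hx))

lemma xEE_int {e : ℝ} (he : 0 < e) {g : ℝ → ℝ} (hg : Continuous g) (hb : ∀ x, 0 ≤ x → |g x| ≤ 1) :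
    MeasureTheory.IntegrableOn (fun x : ℝ => (x : ℂ) * EE e x * (g x : ℂ)) (Ioi 0) := by
  refine MeasureTheory.Integrable.mono' (xexp_integrable he) ?_ ?_
  · exact ((Complex.continuous_ofReal.mul (EE_cont e)).mul (Complex.continuous_ofReal.comp hg)).aestronglyMeasurable
  · refine (MeasureTheory.ae_restrict_mem measurableSet_Ioi).mono fun x hx => ?_
    have hx' : 0 < x := hx
    rw [norm_mul, norm_mul, EE_norm, Complex.norm_real, Complex.norm_real, Real.norm_eq_abs, abs_of_pos hx']
    exact mul_le_of_le_one_right (by positivity) (hb x (le_of_lt hx))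

noncomputable def LL (e : ℝ) : ℂ := ∫ x in Ioi (0:ℝ), EE e x * (BJ 0 x : ℂ)
noncomputable def MM (e : ℝ) : ℂ := ∫ x in Ioi (0:ℝ), (x : ℂ) * EE e x * (BJ 0 x : ℂ)

lemma LL_hasDerivAt {e : ℝ} (he : 0 < e) : HasDerivAt LL (-MM e) e := by
  have key := hasDerivAt_integral_of_dominated_loc_of_deriv_le (𝕜 := ℝ) (μ := MeasureTheory.volume.restrict (Ioi (0:ℝ)))
    (F := fun e x => EE e x * (BJ 0 x : ℂ)) (F' := fun e x => -(x : ℂ) * EE e x * (BJ 0 x : ℂ))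
    (x₀ := e) (s := Ioi (e / 2)) (bound := fun x => x * rexp (-(e / 2 * x)))
    (Ioi_mem_nhds (by linarith))
    (Eventually.of_forall fun e' => ((EE_cont e').mul (Complex.continuous_ofReal.comp (BJ_continuous 0))).aestronglyMeasurable)
    (EE_int he (BJ_continuous 0) (fun x hx => BJ0_abs_le hx))
    (((Complex.continuous_ofReal.neg.mul (EE_cont e)).mul (Complex.continuous_ofReal.comp (BJ_continuous 0))).aestronglyMeasurable)
    ?_ (xexp_integrable (by linarith)) ?_
  · refine key.2.congr_deriv ?_
    rw [MM, ← MeasureTheory.integral_neg]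
    congr 1; ext x; ring
  · refine (MeasureTheory.ae_restrict_mem measurableSet_Ioi).mono fun x hx e' he' => ?_
    have hx' : 0 < x := hx
    have he2 : e / 2 < e' := he'
    rw [norm_mul, norm_mul, norm_neg, EE_norm, Complex.norm_real, Complex.norm_real, Real.norm_eq_abs, abs_of_pos hx']
    refine (mul_le_of_le_one_right (by positivity) (BJ0_abs_le hx'.le)).trans ?_
    gcongr
  · refine Eventually.of_forall fun x e' _ => ?_
    exact (EE_hasDerivAt_e e' x).mul_const _

lemma xexp_tendsto {e : ℝ} (he : 0 < e) : Tendsto (fun x : ℝ => x * rexp (-(e * x))) atTop (nhds 0) := by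
  have h := tendsto_rpow_mul_exp_neg_mul_atTop_nhds_zero 1 e he
  simpa using h

lemma exp_tendsto {e : ℝ} (he : 0 < e) : Tendsto (fun x : ℝ => rexp (-(e * x))) atTop (nhds 0) := by
  have h := tendsto_rpow_mul_exp_neg_mul_atTop_nhds_zero 0 e he
  simpa using h

lemma LM {e : ℝ} (he : 0 < e) :
    (e + Complex.I) * LL e = (1 + ((e:ℂ) + Complex.I) ^ 2) * MM e := by
  set p : ℂ := (e:ℂ) + Complex.I with hp
  have hof : ∀ x : ℝ, HasDerivAt (fun x : ℝ => (x : ℂ)) 1 x := fun x => Complex.ofRealCLM.hasDerivAt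
  have c0 := Complex.continuous_ofReal.comp (BJ_continuous 0)
  have c1 := Complex.continuous_ofReal.comp (BJ_continuous 1)
  have iL := EE_int he (BJ_continuous 0) (fun x hx => BJ0_abs_le hx)
  have iM := xEE_int he (BJ_continuous 0) (fun x hx => BJ0_abs_le hx)
  have key := MeasureTheory.integral_Ioi_of_hasDerivAt_of_tendsto (a := (0:ℝ)) (m := (0:ℂ))
    (f := fun x => EE e x * (-((x : ℂ) * (BJ 1 x : ℂ)) + p * ((x : ℂ) * (BJ 0 x : ℂ))))
    (f' := fun x => p * (EE e x * (BJ 0 x : ℂ)) - (1 + p ^ 2) * ((x : ℂ) * EE e x * (BJ 0 x : ℂ)))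
    ?_ ?_ ?_ ?_
  · rw [MeasureTheory.integral_sub (iL.const_mul _) (iM.const_mul _), MeasureTheory.integral_const_mul,
      MeasureTheory.integral_const_mul] at key
    simp only [Complex.ofReal_zero, zero_mul, mul_zero, neg_zero, add_zero, sub_zero] at key
    exact sub_eq_zero.1 key
  · refine Continuous.continuousWithinAt ?_
    exact (EE_cont e).mul (((Complex.continuous_ofReal.mul c1).neg).add
      (continuous_const.mul (Complex.continuous_ofReal.mul c0)))
  · intro x hx
    have hx' : (x:ℝ) ≠ 0 := ne_of_gt hx
    have hxc : (x:ℂ) ≠ 0 := by exact_mod_cast hx'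
    have h0 := (BJ0_hasDerivAt x).ofReal_comp
    have h1 := (BJ_hasDerivAt' 0 hx').ofReal_comp
    have := (EE_hasDerivAt_x e x).mul ((((hof x).mul h1).neg).add (((hof x).mul h0).const_mul p))
    refine this.congr_deriv ?_
    rw [← hp]
    push_cast
    simp only [zero_add, Pi.add_apply, Pi.neg_apply, Pi.mul_apply]
    field_simp
    ring
  · exact (iL.const_mul _).sub (iM.const_mul _)
  · have hb : Tendsto (fun x : ℝ => (1 + ‖p‖) * (x * rexp (-(e * x)))) atTop (nhds 0) := by
      simpa using (xexp_tendsto he).const_mul (1 + ‖p‖)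
    refine squeeze_zero_norm' ?_ hb
    filter_upwards [eventually_ge_atTop 0] with x hx
    rw [norm_mul, EE_norm]
    have a0 := BJ0_abs_le hx
    have a1 := BJ1_abs_le hx
    have : ‖-((x : ℂ) * (BJ 1 x : ℂ)) + p * ((x : ℂ) * (BJ 0 x : ℂ))‖ ≤ x + ‖p‖ * x := by
      refine (norm_add_le _ _).trans ?_
      rw [norm_neg, norm_mul, norm_mul, norm_mul, Complex.norm_real, Complex.norm_real, Complex.norm_real,
        Real.norm_eq_abs, Real.norm_eq_abs, Real.norm_eq_abs, abs_of_nonneg hx]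
      have := norm_nonneg p
      gcongr
      · exact mul_le_of_le_one_right hx a1
      · exact mul_le_of_le_one_right hx a0
    calc _ ≤ rexp (-(e * x)) * (x + ‖p‖ * x) := by gcongr
      _ = _ := by ring

lemma LL_large {e : ℝ} (he : 0 < e) : ‖((e:ℂ) + Complex.I) * LL e - 1‖ ≤ 1 / e := by
  set p : ℂ := (e:ℂ) + Complex.I with hp
  have iL := EE_int he (BJ_continuous 0) (fun x hx => BJ0_abs_le hx)
  have iN := EE_int he (BJ_continuous 1) (fun x hx => BJ1_abs_le hx)
  have key := MeasureTheory.integral_Ioi_of_hasDerivAt_of_tendsto' (a := (0:ℝ)) (m := (0:ℂ))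
    (f := fun x => EE e x * (BJ 0 x : ℂ))
    (f' := fun x => -p * (EE e x * (BJ 0 x : ℂ)) - (EE e x * (BJ 1 x : ℂ)))
    ?_ ?_ ?_
  · rw [MeasureTheory.integral_sub (iL.const_mul _) iN, MeasureTheory.integral_const_mul] at key
    have e1 : p * LL e - 1 = - ∫ x in Ioi (0:ℝ), EE e x * (BJ 1 x : ℂ) := by
      rw [BJ0_zero] at key
      simp only [EE, Complex.ofReal_zero, mul_zero, neg_zero, Complex.exp_zero, Complex.ofReal_one, mul_one] at key
      simp only [LL, EE]
      linear_combination -key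
    rw [e1, norm_neg]
    have hle : ‖∫ x in Ioi (0:ℝ), EE e x * (BJ 1 x : ℂ)‖ ≤ ∫ x in Ioi (0:ℝ), rexp (-(e * x)) := by
      refine MeasureTheory.norm_integral_le_of_norm_le (exp_integrable he 0) ?_
      refine (MeasureTheory.ae_restrict_mem measurableSet_Ioi).mono fun x hx => ?_
      rw [norm_mul, EE_norm, Complex.norm_real]
      exact mul_le_of_le_one_right (exp_pos _).le (BJ1_abs_le (le_of_lt hx))
    refine hle.trans (le_of_eq ?_)
    have := integral_exp_mul_Ioi (a := -e) (by linarith) 0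
    simp only [neg_mul] at this
    rw [this]; simp
  · intro x _
    have h0 := (BJ0_hasDerivAt x).ofReal_comp
    refine ((EE_hasDerivAt_x e x).mul h0).congr_deriv ?_
    rw [← hp]; push_cast; ring
  · exact (iL.const_mul _).sub iN
  · refine squeeze_zero_norm' ?_ (exp_tendsto he)
    filter_upwards [eventually_ge_atTop 0] with x hx
    rw [norm_mul, EE_norm, Complex.norm_real]
    exact mul_le_of_le_one_right (exp_pos _).le (BJ0_abs_le hx)

lemma p_ne {e : ℝ} (he : 0 < e) : (e:ℂ) + Complex.I ≠ 0 := by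
  intro h
  have := congrArg Complex.im h
  simp at this

lemma LL_sq {e : ℝ} (he : 0 < e) : (1 + ((e:ℂ) + Complex.I) ^ 2) * LL e ^ 2 = 1 := by
  set G : ℝ → ℂ := fun e => (1 + ((e:ℂ) + Complex.I) ^ 2) * LL e ^ 2 with hG
  have hd : ∀ t : ℝ, 0 < t → HasDerivAt G 0 t := by
    intro t ht
    have hof : HasDerivAt (fun x : ℝ => (x : ℂ)) 1 t := Complex.ofRealCLM.hasDerivAt
    have := (((hof.add_const Complex.I).pow 2).const_add 1).mul ((LL_hasDerivAt ht).pow 2)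
    refine this.congr_deriv ?_
    have lm := LM ht
    simp
    linear_combination 2 * LL t * lm
  have hconst : ∀ t : ℝ, 0 < t → G t = G e := by
    intro t ht
    refine (convex_Ioi (0:ℝ)).is_const_of_fderivWithin_eq_zero (𝕜 := ℝ) (f := G) ?_ ?_ ht he
    · intro s hs; exact (hd s hs).differentiableAt.differentiableWithinAt
    · intro s hs
      rw [fderivWithin_of_isOpen isOpen_Ioi hs]
      ext; simp [(hd s hs).deriv]
  have hlim : Tendsto G atTop (nhds 1) := by
    have hinv : Tendsto (fun t : ℝ => 1 / t) atTop (nhds 0) := by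
      simpa using tendsto_inv_atTop_zero
    have l1 : Tendsto (fun t : ℝ => ((t:ℂ) + Complex.I) * LL t) atTop (nhds 1) := by
      rw [tendsto_iff_norm_sub_tendsto_zero]
      refine squeeze_zero' (Eventually.of_forall fun _ => norm_nonneg _) ?_ hinv
      filter_upwards [eventually_gt_atTop 0] with t ht using LL_large ht
    have l2 : Tendsto (fun t : ℝ => (((t:ℂ) + Complex.I))⁻¹) atTop (nhds 0) := by
      refine squeeze_zero_norm' ?_ hinv
      filter_upwards [eventually_gt_atTop 0] with t ht
      rw [norm_inv, one_div]
      have : t ≤ ‖(t:ℂ) + Complex.I‖ := by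
        have := Complex.re_le_norm ((t:ℂ) + Complex.I)
        simpa using this
      gcongr
    have := ((l2.pow 2).add_const 1).mul (l1.pow 2)
    simp only [ne_eq, OfNat.ofNat_ne_zero, not_false_eq_true, zero_pow, zero_add, one_pow, mul_one] at this
    refine this.congr' ?_
    filter_upwards [eventually_gt_atTop 0] with t ht
    have := p_ne ht
    simp only [hG]
    field_simp
  have hc : Tendsto G atTop (nhds (G e)) := by
    refine tendsto_const_nhds.congr' ?_
    filter_upwards [eventually_gt_atTop 0] with t ht using (hconst t ht).symm
  exact tendsto_nhds_unique hc hlim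


noncomputable def FF (e x : ℝ) : ℂ := Complex.exp (-((e + 2 * Complex.I) * x))

lemma FF_norm (e x : ℝ) : ‖FF e x‖ = rexp (-(e * x)) := by
  rw [FF, Complex.norm_exp]; simp

lemma FF_cont (e : ℝ) : Continuous (FF e) := by unfold FF; fun_prop

lemma FF_hasDerivAt_x (e x : ℝ) : HasDerivAt (FF e) (-(e + 2 * Complex.I) * FF e x) x := by
  have h1 : HasDerivAt (fun x : ℝ => (x : ℂ)) 1 x := Complex.ofRealCLM.hasDerivAt
  have := ((h1.const_mul ((e : ℂ) + 2 * Complex.I)).neg).cexp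
  refine this.congr_deriv ?_
  simp [FF]; ring

lemma rp_meas (s : ℝ) : MeasureTheory.AEStronglyMeasurable (fun x : ℝ => ((x ^ s : ℝ) : ℂ))
    (MeasureTheory.volume.restrict (Ioi 1)) := by
  refine ContinuousOn.aestronglyMeasurable ?_ measurableSet_Ioi
  refine Complex.continuous_ofReal.comp_continuousOn ?_
  intro x hx
  have : (0:ℝ) < x := lt_trans one_pos hx
  exact (continuousAt_rpow_const x s (Or.inl this.ne')).continuousWithinAt

lemma rp_int {s e : ℝ} (hs : s ≤ 0) (he : 0 < e) {g : ℝ → ℂ} (hg : Continuous g)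
    (hb : ∀ x, ‖g x‖ ≤ rexp (-(e * x))) :
    MeasureTheory.IntegrableOn (fun x : ℝ => ((x ^ s : ℝ) : ℂ) * g x) (Ioi 1) := by
  refine MeasureTheory.Integrable.mono' (exp_integrable he 1) ?_ ?_
  · exact (rp_meas s).mul hg.aestronglyMeasurable
  · refine (MeasureTheory.ae_restrict_mem measurableSet_Ioi).mono fun x hx => ?_
    have hx1 : (1:ℝ) < x := hx
    rw [norm_mul, Complex.norm_real, Real.norm_eq_abs, abs_of_nonneg (by positivity)]
    refine (mul_le_of_le_one_left (norm_nonneg _) ?_).trans (hb x)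
    exact Real.rpow_le_one_of_one_le_of_nonpos hx1.le hs

noncomputable def K1 : ℝ := ∫ x in Ioi (1:ℝ), x ^ (-(3/2) : ℝ)

lemma K1_int : MeasureTheory.IntegrableOn (fun x : ℝ => x ^ (-(3/2) : ℝ)) (Ioi 1) :=
  integrableOn_Ioi_rpow_of_lt (by norm_num) one_pos

lemma norm_le_K1 {g : ℝ → ℂ} {C : ℝ} (hg : ∀ x, 1 < x → ‖g x‖ ≤ C * x ^ (-(3/2) : ℝ)) :
    ‖∫ x in Ioi (1:ℝ), g x‖ ≤ C * K1 := by
  rw [K1, ← MeasureTheory.integral_const_mul]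
  refine MeasureTheory.norm_integral_le_of_norm_le (K1_int.const_mul C) ?_
  exact (MeasureTheory.ae_restrict_mem measurableSet_Ioi).mono fun x hx => hg x hx

lemma FF_bound {e : ℝ} (he : 0 < e) :
    ‖∫ x in Ioi (1:ℝ), ((x ^ (-(1/2) : ℝ) : ℝ) : ℂ) * FF e x‖ ≤ 1 + K1 := by
  set r : ℂ := (e:ℂ) + 2 * Complex.I with hr
  have i1 := rp_int (s := -(1/2)) (by norm_num) he (FF_cont e) (fun x => (FF_norm e x).le)
  have i2 := rp_int (s := -(3/2)) (by norm_num) he (FF_cont e) (fun x => (FF_norm e x).le)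
  have key := MeasureTheory.integral_Ioi_of_hasDerivAt_of_tendsto' (a := (1:ℝ)) (m := (0:ℂ))
    (f := fun x : ℝ => ((x ^ (-(1/2) : ℝ) : ℝ) : ℂ) * FF e x)
    (f' := fun x : ℝ => (-(1/2)) * (((x ^ (-(3/2) : ℝ) : ℝ) : ℂ) * FF e x)
      - r * (((x ^ (-(1/2) : ℝ) : ℝ) : ℂ) * FF e x))
    ?_ ?_ ?_
  · rw [MeasureTheory.integral_sub (i2.const_mul _) (i1.const_mul _), MeasureTheory.integral_const_mul,
      MeasureTheory.integral_const_mul] at key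
    have b2 : ‖∫ x in Ioi (1:ℝ), ((x ^ (-(3/2) : ℝ) : ℝ) : ℂ) * FF e x‖ ≤ 1 * K1 := by
      refine norm_le_K1 fun x hx => ?_
      rw [norm_mul, Complex.norm_real, Real.norm_eq_abs, abs_of_nonneg (by positivity), FF_norm, mul_comm]
      gcongr
      rw [exp_le_one_iff]; have := mul_pos he (one_pos.trans hx); linarith
    set I1 := ∫ x in Ioi (1:ℝ), ((x ^ (-(1/2) : ℝ) : ℝ) : ℂ) * FF e x with hI1
    set I2 := ∫ x in Ioi (1:ℝ), ((x ^ (-(3/2) : ℝ) : ℝ) : ℂ) * FF e x with hI2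
    have e1 : r * I1 = FF e 1 - (1/2) * I2 := by
      simp only [Real.one_rpow, Complex.ofReal_one, one_mul] at key
      linear_combination -key
    have nr : 1 ≤ ‖r‖ := by
      have := Complex.abs_im_le_norm r
      have h2 : r.im = 2 := by simp [hr]
      rw [h2] at this; norm_num at this; linarith
    have : ‖r‖ * ‖I1‖ ≤ 1 + K1 := by
      rw [← norm_mul, e1]
      refine (norm_sub_le _ _).trans ?_
      rw [FF_norm, norm_mul]
      have h3 : rexp (-(e * 1)) ≤ 1 := by rw [exp_le_one_iff]; linarith
      have h4 : ‖(1/2:ℂ)‖ = 1/2 := by norm_num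
      rw [h4]
      have := norm_nonneg I2
      linarith
    refine le_trans ?_ this
    exact le_mul_of_one_le_left (norm_nonneg _) nr
  · intro x hx
    have hx0 : (0:ℝ) < x := lt_of_lt_of_le one_pos hx
    have h0 := (Real.hasDerivAt_rpow_const (x := x) (p := -(1/2)) (Or.inl hx0.ne')).ofReal_comp
    refine (h0.mul (FF_hasDerivAt_x e x)).congr_deriv ?_
    rw [show (-(1/2) - 1 : ℝ) = -(3/2) by norm_num, ← hr]
    push_cast
    ring
  · exact (i2.const_mul _).sub (i1.const_mul _)
  · refine squeeze_zero_norm' ?_ (exp_tendsto he)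
    filter_upwards [eventually_ge_atTop 1] with x hx
    rw [norm_mul, FF_norm, Complex.norm_real, Real.norm_eq_abs, abs_of_nonneg (by positivity)]
    exact mul_le_of_le_one_left (exp_pos _).le (Real.rpow_le_one_of_one_le_of_nonpos hx (by norm_num))

noncomputable def K0 : ℝ := ∫ x in Ioc (0:ℝ) 1, x ^ (-(1/2) : ℝ)

lemma GG_bound {e : ℝ} (he : 0 < e) :
    |(∫ x in Ioi (1:ℝ), x ^ (-(1/2) : ℝ) * rexp (-(e * x))) - √π / √e| ≤ K0 := by
  have hGint : MeasureTheory.IntegrableOn (fun x : ℝ => x ^ (-(1/2) : ℝ) * rexp (-(e * x))) (Ioi 0) := by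
    have := integrableOn_rpow_mul_exp_neg_mul_rpow (p := 1) (s := -(1/2)) (b := e) (by norm_num) (by norm_num) he
    simpa using this
  have hfull := Real.integral_rpow_mul_exp_neg_mul_Ioi (a := 1/2) (r := e) (by norm_num) he
  rw [show (1/2 - 1 : ℝ) = -(1/2) by norm_num, Real.Gamma_one_half_eq] at hfull
  have hsplit : (∫ x in Ioi (0:ℝ), x ^ (-(1/2) : ℝ) * rexp (-(e * x))) =
      (∫ x in Ioc (0:ℝ) 1, x ^ (-(1/2) : ℝ) * rexp (-(e * x))) +
      ∫ x in Ioi (1:ℝ), x ^ (-(1/2) : ℝ) * rexp (-(e * x)) := by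
    rw [← Ioc_union_Ioi_eq_Ioi (zero_le_one (α := ℝ)), MeasureTheory.setIntegral_union
      (Ioc_disjoint_Ioi le_rfl) measurableSet_Ioi (hGint.mono_set Ioc_subset_Ioi_self)
      (hGint.mono_set (Ioi_subset_Ioi zero_le_one))]
  have hs : (1 / e) ^ (1/2 : ℝ) * √π = √π / √e := by
    rw [← Real.sqrt_eq_rpow, Real.sqrt_div zero_le_one, Real.sqrt_one]; ring
  rw [hs, hsplit] at hfull
  rw [← hfull]
  have : |∫ x in Ioc (0:ℝ) 1, x ^ (-(1/2) : ℝ) * rexp (-(e * x))| ≤ K0 := by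
    rw [K0, ← Real.norm_eq_abs]
    refine MeasureTheory.norm_integral_le_of_norm_le ?_ ?_
    · have := (intervalIntegral.intervalIntegrable_rpow' (r := -(1/2)) (a := 0) (b := 1) (by norm_num))
      rwa [intervalIntegrable_iff_integrableOn_Ioc_of_le zero_le_one] at this
    · refine (MeasureTheory.ae_restrict_mem measurableSet_Ioc).mono fun x hx => ?_
      have hx0 : 0 < x := hx.1
      rw [Real.norm_eq_abs, abs_of_nonneg (by positivity)]
      refine mul_le_of_le_one_right (by positivity) ?_
      rw [exp_le_one_iff]; have := mul_pos he hx0; linarith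
  rw [abs_sub_comm]
  simpa using this

lemma EE_decomp (Z : ℂ) (e x : ℝ) (hx : 1 < x) :
    EE e x * (BJ 0 x : ℂ) = Z / (2 * Complex.I) * ((x ^ (-(1/2) : ℝ) * rexp (-(e * x)) : ℝ) : ℂ)
      - (starRingEnd ℂ) Z / (2 * Complex.I) * (((x ^ (-(1/2) : ℝ) : ℝ) : ℂ) * FF e x)
      + ((x ^ (-(1/2) : ℝ) : ℝ) : ℂ) * (EE e x * ((v0 x - (Z * Complex.exp (Complex.I * x)).im : ℝ) : ℂ)) := by
  have hx0 : 0 < x := by linarith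
  have hxs : x ^ (-(1/2) : ℝ) * √x = 1 := by
    rw [Real.sqrt_eq_rpow, ← Real.rpow_add hx0]; norm_num
  have him : (((Z * Complex.exp (Complex.I * x)).im : ℝ) : ℂ) =
      (Z * Complex.exp (Complex.I * x) - (starRingEnd ℂ) Z * Complex.exp (-(Complex.I * x))) / (2 * Complex.I) := by
    have hc : (starRingEnd ℂ) (Z * Complex.exp (Complex.I * x)) = (starRingEnd ℂ) Z * Complex.exp (-(Complex.I * x)) := by
      rw [map_mul, ← Complex.exp_conj]; simp
    rw [← hc, Complex.im_eq_sub_conj]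
  have h1 : (BJ 0 x : ℂ) = ((x ^ (-(1/2) : ℝ) : ℝ) : ℂ) * (v0 x : ℂ) := by
    rw [v0, ← Complex.ofReal_mul, ← mul_assoc, hxs, one_mul]
  have e1 : EE e x * Complex.exp (Complex.I * x) = ((rexp (-(e * x)) : ℝ) : ℂ) := by
    rw [EE, ← Complex.exp_add, Complex.ofReal_exp]; congr 1; push_cast; ring
  have e2 : EE e x * Complex.exp (-(Complex.I * x)) = FF e x := by
    rw [EE, FF, ← Complex.exp_add]; congr 1; ring
  rw [h1, Complex.ofReal_sub, him, Complex.ofReal_mul, ← e1, ← e2]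
  field_simp
  ring

lemma LL_asymp (Z : ℂ) (C : ℝ) (hC : 0 ≤ C)
    (hZ : ∀ x : ℝ, 1 ≤ x → |v0 x - (Z * Complex.exp (Complex.I * x)).im| ≤ C / x) :
    ∃ B : ℝ, ∀ e : ℝ, 0 < e → ‖LL e - Z / (2 * Complex.I) * ((√π / √e : ℝ) : ℂ)‖ ≤ B := by
  refine ⟨1 + ‖Z / (2 * Complex.I)‖ * K0 + ‖(starRingEnd ℂ) Z / (2 * Complex.I)‖ * (1 + K1) + C * K1, ?_⟩
  intro e he
  have iL := EE_int he (BJ_continuous 0) (fun x hx => BJ0_abs_le hx)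
  have hsplit : LL e = (∫ x in Ioc (0:ℝ) 1, EE e x * (BJ 0 x : ℂ)) + ∫ x in Ioi (1:ℝ), EE e x * (BJ 0 x : ℂ) := by
    rw [LL, ← Ioc_union_Ioi_eq_Ioi (zero_le_one (α := ℝ)), MeasureTheory.setIntegral_union
      (Ioc_disjoint_Ioi le_rfl) measurableSet_Ioi (iL.mono_set Ioc_subset_Ioi_self)
      (iL.mono_set (Ioi_subset_Ioi zero_le_one))]
  have b1 : ‖∫ x in Ioc (0:ℝ) 1, EE e x * (BJ 0 x : ℂ)‖ ≤ 1 := by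
    have := MeasureTheory.norm_setIntegral_le_of_norm_le_const (μ := MeasureTheory.volume) (s := Ioc (0:ℝ) 1)
      (f := fun x => EE e x * (BJ 0 x : ℂ)) (C := 1) (by simp) (by
        intro x hx
        rw [norm_mul, EE_norm, Complex.norm_real]
        have h1 : rexp (-(e * x)) ≤ 1 := by
          rw [exp_le_one_iff]; have := mul_pos he hx.1; linarith
        exact mul_le_one₀ h1 (norm_nonneg _) (BJ0_abs_le hx.1.le))
    simpa using this
  have i1 : MeasureTheory.IntegrableOn (fun x : ℝ => Z / (2 * Complex.I) * ((x ^ (-(1/2) : ℝ) * rexp (-(e * x)) : ℝ) : ℂ)) (Ioi 1) := by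
    have := rp_int (s := -(1/2)) (g := fun x => ((rexp (-(e * x)) : ℝ) : ℂ)) (by norm_num) he
      (by fun_prop) (fun x => by rw [Complex.norm_real, Real.norm_eq_abs, abs_of_pos (exp_pos _)])
    simpa [MeasureTheory.IntegrableOn] using this.const_mul (Z / (2 * Complex.I))
  have i2 := (rp_int (s := -(1/2)) (by norm_num) he (FF_cont e) (fun x => (FF_norm e x).le)).const_mul
    ((starRingEnd ℂ) Z / (2 * Complex.I))
  have iE : MeasureTheory.IntegrableOn (fun x => EE e x * (BJ 0 x : ℂ)) (Ioi 1) :=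
    iL.mono_set (Ioi_subset_Ioi zero_le_one)
  set R : ℝ → ℂ := fun x => ((x ^ (-(1/2) : ℝ) : ℝ) : ℂ) * (EE e x * ((v0 x - (Z * Complex.exp (Complex.I * x)).im : ℝ) : ℂ)) with hR
  have i3 : MeasureTheory.IntegrableOn R (Ioi 1) := by
    refine ((iE.sub i1).add i2).congr_fun ?_ measurableSet_Ioi
    intro x hx
    simp only [Pi.add_apply, Pi.sub_apply]
    rw [EE_decomp Z e x hx]
    simp only [hR]
    ring
  have b3 : ‖∫ x in Ioi (1:ℝ), R x‖ ≤ C * K1 := by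
    refine norm_le_K1 fun x hx => ?_
    have hx0 : 0 < x := by linarith
    rw [hR, norm_mul, norm_mul, Complex.norm_real, Complex.norm_real, EE_norm, Real.norm_eq_abs,
      abs_of_nonneg (by positivity)]
    have h1 : rexp (-(e * x)) ≤ 1 := by
      rw [exp_le_one_iff]; have := mul_pos he hx0; linarith
    have h2 := hZ x hx.le
    have h3 : x ^ (-(3/2) : ℝ) = x ^ (-(1/2) : ℝ) / x := by
      rw [show (-(3/2) : ℝ) = -(1/2) - 1 by norm_num, Real.rpow_sub_one hx0.ne']
    calc _ ≤ x ^ (-(1/2) : ℝ) * (1 * (C / x)) := by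
          rw [Real.norm_eq_abs]
          gcongr
      _ = _ := by rw [h3]; ring
  have hI : ∫ x in Ioi (1:ℝ), EE e x * (BJ 0 x : ℂ) =
      Z / (2 * Complex.I) * ((∫ x in Ioi (1:ℝ), x ^ (-(1/2) : ℝ) * rexp (-(e * x)) : ℝ) : ℂ)
      - (starRingEnd ℂ) Z / (2 * Complex.I) * (∫ x in Ioi (1:ℝ), ((x ^ (-(1/2) : ℝ) : ℝ) : ℂ) * FF e x)
      + ∫ x in Ioi (1:ℝ), R x := by
    rw [← integral_complex_ofReal, ← MeasureTheory.integral_const_mul, ← MeasureTheory.integral_const_mul,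
      ← MeasureTheory.integral_sub i1 i2]
    refine Eq.trans ?_ (MeasureTheory.integral_add (i1.sub i2) i3)
    exact MeasureTheory.setIntegral_congr_fun measurableSet_Ioi fun x hx => EE_decomp Z e x hx
  have b4 := GG_bound he
  have b5 := FF_bound he
  set A1 := ∫ x in Ioc (0:ℝ) 1, EE e x * (BJ 0 x : ℂ)
  set G := ∫ x in Ioi (1:ℝ), x ^ (-(1/2) : ℝ) * rexp (-(e * x))
  set F := ∫ x in Ioi (1:ℝ), ((x ^ (-(1/2) : ℝ) : ℝ) : ℂ) * FF e x
  set Q := ∫ x in Ioi (1:ℝ), R x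
  have e1 : LL e - Z / (2 * Complex.I) * ((√π / √e : ℝ) : ℂ) =
      A1 + Z / (2 * Complex.I) * ((G - √π / √e : ℝ) : ℂ) - (starRingEnd ℂ) Z / (2 * Complex.I) * F + Q := by
    rw [hsplit, hI, Complex.ofReal_sub]; ring
  rw [e1]
  refine (norm_add_le _ _).trans ?_
  refine add_le_add ?_ b3
  refine (norm_sub_le _ _).trans ?_
  rw [norm_mul ((starRingEnd ℂ) Z / (2 * Complex.I))]
  refine add_le_add ?_ (by gcongr)
  refine (norm_add_le _ _).trans ?_
  rw [norm_mul, Complex.norm_real, Real.norm_eq_abs]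
  exact add_le_add b1 (by gcongr)

lemma Z_sq (Z : ℂ) (C : ℝ) (hC : 0 ≤ C)
    (hZ : ∀ x : ℝ, 1 ≤ x → |v0 x - (Z * Complex.exp (Complex.I * x)).im| ≤ C / x) :
    Z ^ 2 = 2 * Complex.I / π := by
  obtain ⟨B, hB⟩ := LL_asymp Z C hC hZ
  have hs0 : Tendsto (fun e : ℝ => √e) (nhdsWithin 0 (Ioi 0)) (nhds 0) := by
    have := (Real.continuous_sqrt.tendsto 0).mono_left (nhdsWithin_le_nhds (s := Ioi 0))
    simpa using this
  have l1 : Tendsto (fun e : ℝ => ((√e : ℝ) : ℂ) * LL e) (nhdsWithin 0 (Ioi 0))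
      (nhds (Z / (2 * Complex.I) * ((√π : ℝ) : ℂ))) := by
    rw [tendsto_iff_norm_sub_tendsto_zero]
    refine squeeze_zero' (Eventually.of_forall fun _ => norm_nonneg _) ?_ (by simpa using hs0.mul_const B)
    filter_upwards [self_mem_nhdsWithin] with e he
    have he0 : (0:ℝ) < e := he
    have hse : 0 < √e := Real.sqrt_pos.2 he0
    have hsc : ((√e : ℝ) : ℂ) ≠ 0 := by exact_mod_cast hse.ne'
    have : ((√e : ℝ) : ℂ) * LL e - Z / (2 * Complex.I) * ((√π : ℝ) : ℂ) =
        ((√e : ℝ) : ℂ) * (LL e - Z / (2 * Complex.I) * ((√π / √e : ℝ) : ℂ)) := by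
      rw [Complex.ofReal_div]; field_simp
    rw [this, norm_mul, Complex.norm_real, Real.norm_eq_abs, abs_of_pos hse]
    exact mul_le_mul_of_nonneg_left (hB e he0) hse.le
  have l2 : Tendsto (fun e : ℝ => (((√e : ℝ) : ℂ) * LL e) ^ 2) (nhdsWithin 0 (Ioi 0))
      (nhds (1 / (2 * Complex.I))) := by
    have h : Tendsto (fun e : ℝ => 1 / ((e:ℂ) + 2 * Complex.I)) (nhdsWithin 0 (Ioi 0)) (nhds (1 / (2 * Complex.I))) := by
      have hc : ContinuousAt (fun e : ℝ => 1 / ((e:ℂ) + 2 * Complex.I)) 0 := by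
        refine ContinuousAt.div continuousAt_const (by fun_prop) ?_
        simp
      have := hc.tendsto.mono_left (nhdsWithin_le_nhds (s := Ioi 0))
      simpa using this
    refine h.congr' ?_
    filter_upwards [self_mem_nhdsWithin] with e he
    have he0 : (0:ℝ) < e := he
    have h1 := LL_sq he0
    have h2 : ((√e : ℝ) : ℂ) ^ 2 = e := by exact_mod_cast Real.sq_sqrt he0.le
    have h3 : (e:ℂ) + 2 * Complex.I ≠ 0 := by
      intro h
      have := congrArg Complex.im h
      simp at this
    rw [mul_pow, h2, div_eq_iff h3, ← h1]
    linear_combination LL e ^ 2 * Complex.I_sq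
  have := tendsto_nhds_unique (l1.pow 2) l2
  have h2 : ((√π : ℝ) : ℂ) ^ 2 = π := by exact_mod_cast Real.sq_sqrt pi_pos.le
  have hpi : (π : ℂ) ≠ 0 := by exact_mod_cast pi_ne_zero
  rw [mul_pow, h2, div_pow, mul_pow, Complex.I_sq] at this
  rw [eq_div_iff hpi]
  have h3 : 1 / (2 * Complex.I) = -Complex.I / 2 := by
    rw [one_div, mul_inv, Complex.inv_I]; ring
  rw [h3] at this
  linear_combination (-4) * this


lemma z1_ge {z : ℕ → ℝ} (h : ZE 0 z) : 1 ≤ z 1 := by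
  have hp := h.pos 1 le_rfl
  have := (convex_Icc (0:ℝ) (z 1)).norm_image_sub_le_of_norm_hasDerivWithin_le (f := BJ 0)
    (f' := fun x => -BJ 1 x) (C := 1) (x := 0) (y := z 1)
    (fun x _ => (BJ0_hasDerivAt x).hasDerivWithinAt)
    (fun x hx => by rw [norm_neg]; exact BJ1_abs_le hx.1) ⟨le_rfl, hp.le⟩ ⟨hp.le, le_rfl⟩
  rw [h.zero 1 le_rfl, BJ0_zero] at this
  simp only [zero_sub, norm_neg, norm_one, sub_zero, one_mul, Real.norm_eq_abs, abs_of_pos hp] at this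
  exact this

lemma SS0 {x : ℝ} (hx : 0 < x) : SS 0 x = x := by
  simp [SS, Real.sqrt_sq hx.le]

lemma z1_le {z : ℕ → ℝ} (h : ZE 0 z) : z 1 ≤ π := by
  by_contra hcon
  push Not at hcon
  have hp := h.pos 1 le_rfl
  set x := (z 1 - π) / 2 with hx
  have hx0 : 0 < x := by rw [hx]; linarith
  have hxz : x < z 1 := by have := pi_pos; rw [hx]; linarith
  have hx0' : x ∈ Ioi ((0:ℕ):ℝ) := by simpa using hx0
  have hz0' : z 1 ∈ Ioi ((0:ℕ):ℝ) := by simpa using hp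
  have hT := TT_mono 0 hx0' hz0' hxz.le
  simp only [TT, SS0 hx0, SS0 hp] at hT
  have hs := (PH_spec 0 _ hz0').2.2.1 (h.zero 1 le_rfl)
  have hIVT := intermediate_value_Icc hxz.le (f := PH 0) (fun t ht =>
    (PH_continuousAt (n := 0) (by simpa using lt_of_lt_of_le hx0 ht.1)).continuousWithinAt)
  have hmem : PH 0 (z 1) - π ∈ Icc (PH 0 x) (PH 0 (z 1)) := by
    have := pi_pos
    refine ⟨?_, by linarith⟩
    rw [hx] at hT ⊢; linarith
  obtain ⟨y, hy, hyP⟩ := hIVT hmem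
  have hy0 : 0 < y := lt_of_lt_of_le hx0 hy.1
  have hyz : BJ 0 y = 0 := by
    refine (PH_spec 0 y (by simpa using hy0)).2.2.2 ?_
    rw [hyP, Real.sin_sub_pi, hs, neg_zero]
  obtain ⟨m, hm, hmy⟩ := h.all y hy0 hyz
  have := h.mono_le le_rfl hm
  have hyeq : y = z 1 := le_antisymm hy.2 (by rw [← hmy]; exact this)
  rw [hyeq] at hyP
  have := pi_pos
  linarith

lemma c0_val {z : ℕ → ℝ} (h : ZE 0 z) : Tendsto (fun m => z m - m * π) atTop (nhds (-(π / 4))) := by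
  obtain ⟨c, hc, hb⟩ := h.lim
  have hp := h.pos 1 le_rfl
  have h1 := z1_ge h
  have h2 := z1_le h
  have hpi := Real.pi_gt_three
  obtain ⟨hu, hl⟩ := hb 1 1 le_rfl (by simpa using hp) one_pos (by simp)
  rw [SS0 hp] at hu hl
  simp only [Nat.cast_zero, zero_mul, sub_zero, Nat.cast_one, one_mul, one_pow, mul_one] at hu hl
  have h3 : 5 / 4 / z 1 ≤ 5 / 4 := div_le_self (by norm_num) h1
  have h4 : (5 / 4 / z 1) * z 1 = 5 / 4 := by field_simp
  have h5 : -π - 1 / 4 ≤ z 1 - π - 5 / 4 / z 1 := by linarith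
  have hlow : -π - 1 / 4 ≤ c := h5.trans hl
  have hup : c ≤ 0 := by linarith
  obtain ⟨Z, C, hC, hZ⟩ := J0_asymp
  have hZ2 := Z_sq Z C hC hZ
  -- the limit phase
  have him : (Z * Complex.exp (Complex.I * c)).im = 0 := by
    have t1 : Tendsto (fun k => (Z * Complex.exp (Complex.I * ((z k - k * π : ℝ) : ℂ))).im) atTop
        (nhds (Z * Complex.exp (Complex.I * c)).im) := by
      have hcont : Continuous (fun t : ℝ => (Z * Complex.exp (Complex.I * (t : ℂ))).im) := by fun_prop
      exact (hcont.tendsto c).comp hc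
    have t2 : Tendsto (fun k => (Z * Complex.exp (Complex.I * ((z k - k * π : ℝ) : ℂ))).im) atTop (nhds 0) := by
      have hCz : Tendsto (fun k => C / z k) atTop (nhds 0) := tendsto_const_nhds.div_atTop h.tendsto
      refine squeeze_zero_norm' ?_ hCz
      filter_upwards [eventually_ge_atTop 1] with k hk
      have hzk : 1 ≤ z k := h1.trans (h.mono_le le_rfl hk)
      have := hZ (z k) hzk
      rw [v0, h.zero k hk, mul_zero, zero_sub, abs_neg] at this
      have e1 : Complex.exp (Complex.I * ((z k - k * π : ℝ) : ℂ)) = ((((-1) ^ k : ℝ)) : ℂ) * Complex.exp (Complex.I * (z k : ℂ)) := by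
        have e2 : Complex.exp (-((k:ℂ) * (π * Complex.I))) = (((-1) ^ k : ℝ) : ℂ) := by
          rw [Complex.exp_neg, Complex.exp_nat_mul, Complex.exp_pi_mul_I]
          push_cast
          rw [← inv_pow]; norm_num
        rw [← e2, ← Complex.exp_add]; congr 1; push_cast; ring
      rw [e1, mul_left_comm, Complex.im_ofReal_mul, norm_mul, norm_pow, norm_neg, norm_one, one_pow, one_mul, Real.norm_eq_abs]
      exact this
    exact tendsto_nhds_unique t1 t2
  have hsq : (Z * Complex.exp (Complex.I * c)) ^ 2 = ((2 / π : ℝ) : ℂ) * (Complex.I * Complex.exp (((2 * c : ℝ) : ℂ) * Complex.I)) := by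
    rw [mul_pow, hZ2, ← Complex.exp_nat_mul]
    push_cast
    rw [show (2 : ℂ) * (Complex.I * c) = 2 * c * Complex.I by ring]
    ring
  have hWr : Z * Complex.exp (Complex.I * c) = (((Z * Complex.exp (Complex.I * c)).re : ℝ) : ℂ) := by
    apply Complex.ext <;> simp [him]
  set w := (Z * Complex.exp (Complex.I * c)).re with hw
  rw [hWr] at hsq
  rw [Complex.exp_mul_I, ← Complex.ofReal_cos, ← Complex.ofReal_sin] at hsq
  have hre := congrArg Complex.re hsq
  have him2 := congrArg Complex.im hsq
  rw [← Complex.ofReal_pow, Complex.re_ofReal_mul, Complex.ofReal_re] at hre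
  rw [← Complex.ofReal_pow, Complex.im_ofReal_mul, Complex.ofReal_im] at him2
  have r1 : (Complex.I * (((cos (2 * c) : ℝ) : ℂ) + ((sin (2 * c) : ℝ) : ℂ) * Complex.I)).re = - sin (2 * c) := by
    simp only [Complex.mul_re, Complex.I_re, Complex.I_im, Complex.add_re, Complex.add_im, Complex.ofReal_re, Complex.ofReal_im, Complex.mul_im]
    ring
  have r2 : (Complex.I * (((cos (2 * c) : ℝ) : ℂ) + ((sin (2 * c) : ℝ) : ℂ) * Complex.I)).im = cos (2 * c) := by
    simp only [Complex.mul_re, Complex.I_re, Complex.I_im, Complex.add_re, Complex.add_im, Complex.ofReal_re, Complex.ofReal_im, Complex.mul_im]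
    ring
  rw [r1] at hre
  rw [r2] at him2
  have hpos : 0 < 2 / π := by positivity
  have hcos : cos (2 * c) = 0 := by
    rcases mul_eq_zero.1 him2.symm with h | h
    · exact absurd h hpos.ne'
    · exact h
  have hsin : sin (2 * c) ≤ 0 := by
    by_contra hh
    push Not at hh
    have := mul_pos hpos hh
    nlinarith [sq_nonneg w]
  have hcv : c = -(π / 4) := by
    obtain ⟨m, hm⟩ := Real.cos_eq_zero_iff.1 hcos
    have m1 : m < 0 := by
      by_contra hh
      have : (0:ℝ) ≤ m := by exact_mod_cast not_lt.1 hh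
      nlinarith
    have m2 : -3 < m := by
      by_contra hh
      have : (m:ℝ) ≤ -3 := by exact_mod_cast not_lt.1 hh
      nlinarith
    have hmm : m = -1 ∨ m = -2 := by omega
    rcases hmm with rfl | rfl
    · push_cast at hm; linarith
    · exfalso
      push_cast at hm
      have : 2 * c = π / 2 - 2 * π := by linarith
      rw [this, Real.sin_sub_two_pi, Real.sin_pi_div_two] at hsin
      linarith
  rw [← hcv]; exact hc

lemma c_val (z : ℕ → ℕ → ℝ) (h : ∀ n, ZE n (z n)) (n : ℕ) :
    Tendsto (fun m => z n m - m * π) atTop (nhds (n * (π / 2) - π / 4)) := by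
  induction n with
  | zero => simpa using c0_val (h 0)
  | succ n ih =>
    have := ih.add ((h n).next (h (n + 1)))
    rw [show (n * (π / 2) - π / 4 + π / 2) = ((n + 1 : ℕ) : ℝ) * (π / 2) - π / 4 by push_cast; ring] at this
    refine this.congr ?_
    intro m; ring

lemma zero_est (z : ℕ → ℕ → ℝ) (h : ∀ n, ZE n (z n)) (n k : ℕ) (κ : ℝ) (hk : 1 ≤ k)
    (hn : (n:ℝ) < z n k) (hκ : 0 < κ) (hle : κ * z n k ^ 2 ≤ z n k ^ 2 - n ^ 2) :
    |SS n (z n k) - k * π + π / 4| ≤ 5 / (4 * κ ^ 3) / z n k := by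
  obtain ⟨c, hc, hb⟩ := (h n).lim
  have hcv := tendsto_nhds_unique hc (c_val z h n)
  obtain ⟨h1, h2⟩ := hb k κ hk hn hκ hle
  rw [hcv] at h1 h2
  have : 0 ≤ 5 / (4 * κ ^ 3) / z n k := by
    have := (h n).pos k hk
    positivity
  rw [abs_le]
  constructor <;> linarith

lemma tan_gt {α : ℝ} (hα : 1 < α) : 0 < √(α ^ 2 - 1) - arccos (1 / α) := by
  have h0 : 0 < 1 / α := by positivity
  have h1 : 1 / α < 1 := by rw [div_lt_one (by linarith)]; exact hα
  have a0 : 0 < arccos (1 / α) := Real.arccos_pos.2 h1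
  have a1 : arccos (1 / α) < π / 2 := Real.arccos_lt_pi_div_two.2 h0
  have := Real.lt_tan a0 a1
  rw [Real.tan_arccos] at this
  have e : √(1 - (1 / α) ^ 2) / (1 / α) = √(α ^ 2 - 1) := by
    have hα0 : 0 < α := by linarith
    rw [show 1 - (1 / α) ^ 2 = (α ^ 2 - 1) / α ^ 2 by field_simp, Real.sqrt_div (by nlinarith),
      Real.sqrt_sq hα0.le]
    field_simp
  rw [e] at this
  linarith

lemma SS_lip {n : ℕ} {x y : ℝ} (hx : (n:ℝ) < x) (hy : (n:ℝ) < y) : |SS n y - SS n x| ≤ |y - x| := by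
  have := (convex_Ioi (n:ℝ)).norm_image_sub_le_of_norm_hasDerivWithin_le (f := SS n)
    (f' := fun x => om n x) (C := 1) (x := x) (y := y)
    (fun x hx => (SS_hasDerivAt hx).hasDerivWithinAt)
    (fun x hx => by
      rw [Real.norm_eq_abs, abs_of_pos (om_pos hx)]; exact om_le_one hx) hx hy
  simpa using this

lemma SS_mul {n : ℕ} {α : ℝ} (hn : 1 ≤ n) (hα : 1 < α) :
    SS n (α * n) = n * (√(α ^ 2 - 1) - arccos (1 / α)) := by
  have hn0 : (0:ℝ) < n := by exact_mod_cast hn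
  have hα0 : 0 < α := by linarith
  rw [SS, show (α * n) ^ 2 - (n:ℝ) ^ 2 = (α ^ 2 - 1) * n ^ 2 by ring, Real.sqrt_mul (by nlinarith),
    Real.sqrt_sq hn0.le, show (n:ℝ) / (α * n) = 1 / α by field_simp]
  ring

theorem stmt_18 (α : ℝ) (hα : 1 < α)
    (J : ℝ → ℕ → ℝ)
    (hJpos : ∀ ν : ℝ, 0 ≤ ν → ∀ k : ℕ, 1 ≤ k → 0 < J ν k)
    (hJmono : ∀ ν : ℝ, 0 ≤ ν → ∀ k l : ℕ, 1 ≤ k → k < l → J ν k < J ν l)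
    (hJzero : ∀ ν : ℝ, 0 ≤ ν → ∀ k : ℕ, 1 ≤ k → besselJ ν (J ν k) = 0)
    (hJall : ∀ ν : ℝ, 0 ≤ ν → ∀ z : ℝ, 0 < z → besselJ ν z = 0 →
      ∃ k : ℕ, 1 ≤ k ∧ J ν k = z)
    (k : ℕ → ℕ) (hk : StrictMono k) (hk1 : ∀ i, 1 ≤ k i)
    (ℓ : ℕ → ℕ)
    (hδ : ∀ i, 0 ≤ sigmaF α * k i - ℓ i)
    (hδ0 : Filter.Tendsto (fun i => (sigmaF α * k i - ℓ i) / k i) Filter.atTop (nhds 0))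
    (hconv : Filter.Tendsto (fun i => J (ℓ i) (k i) - α * ℓ i) Filter.atTop (nhds 0)) :
    Filter.Tendsto (fun i => sigmaF α * k i - ℓ i) Filter.atTop (nhds (sigmaF α / 4)) := by
  have hZE : ∀ n : ℕ, ZE n (J (n : ℝ)) := by
    intro n
    have hn : (0:ℝ) ≤ n := Nat.cast_nonneg n
    refine ⟨hJpos n hn, hJmono n hn, ?_, ?_⟩
    · intro k hk; rw [← besselJ_eq]; exact hJzero n hn k hk
    · intro x hx h0; rw [← besselJ_eq] at h0; exact hJall n hn x hx h0
  have hD := tan_gt hα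
  set D := √(α ^ 2 - 1) - arccos (1 / α) with hDdef
  have hσ : sigmaF α = π / D := rfl
  have hσ0 : 0 < sigmaF α := by rw [hσ]; positivity
  have hkr : Tendsto (fun i => (k i : ℝ)) atTop atTop := tendsto_natCast_atTop_atTop.comp hk.tendsto_atTop
  have hl : Tendsto (fun i => (ℓ i : ℝ)) atTop atTop := by
    have h1 : Tendsto (fun i => sigmaF α - (sigmaF α * k i - ℓ i) / k i) atTop (nhds (sigmaF α)) := by
      simpa using hδ0.const_sub (sigmaF α)
    have h2 := h1.pos_mul_atTop hσ0 hkr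
    refine h2.congr ?_
    intro i
    have : (0:ℝ) < k i := by exact_mod_cast hk1 i
    field_simp
    ring
  set β := (1 + α) / 2 with hβ
  have hβ1 : 1 < β := by rw [hβ]; linarith
  set κ := 1 - 1 / β ^ 2 with hκdef
  have hκ : 0 < κ := by
    have : 1 / β ^ 2 < 1 := by rw [div_lt_one (by positivity)]; nlinarith
    rw [hκdef]; linarith
  have hgap : ∀ᶠ i in atTop, β * ℓ i ≤ J (ℓ i) (k i) := by
    have h1 : ∀ᶠ i in atTop, -1 < J (ℓ i) (k i) - α * ℓ i := hconv.eventually_const_lt (by norm_num)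
    have h2 : ∀ᶠ i in atTop, 2 / (α - 1) ≤ (ℓ i : ℝ) := hl.eventually_ge_atTop _
    filter_upwards [h1, h2] with i h1 h2
    rw [div_le_iff₀ (by linarith)] at h2
    rw [hβ]; nlinarith
  -- error term
  have herr : Tendsto (fun i => (ℓ i : ℝ) * D - k i * π + π / 4) atTop (nhds 0) := by
    have hb : Tendsto (fun i => |J (ℓ i) (k i) - α * ℓ i| + 5 / (4 * κ ^ 3) / (ℓ i : ℝ)) atTop (nhds 0) := by
      have h1 := hconv.abs
      have h2 : Tendsto (fun i => 5 / (4 * κ ^ 3) / (ℓ i : ℝ)) atTop (nhds 0) := tendsto_const_nhds.div_atTop hl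
      simpa using h1.add h2
    refine squeeze_zero_norm' ?_ hb
    filter_upwards [hgap, hl.eventually_ge_atTop 1] with i hi hli
    have hli' : 1 ≤ ℓ i := by exact_mod_cast hli
    have hlt : (ℓ i : ℝ) < J (ℓ i) (k i) := by nlinarith
    have hlα : (ℓ i : ℝ) < α * ℓ i := by nlinarith
    have hle : κ * J (ℓ i) (k i) ^ 2 ≤ J (ℓ i) (k i) ^ 2 - (ℓ i : ℝ) ^ 2 := by
      have h1 : (β * ℓ i) ^ 2 ≤ J (ℓ i) (k i) ^ 2 := by gcongr
      have h2 : (ℓ i : ℝ) ^ 2 ≤ J (ℓ i) (k i) ^ 2 / β ^ 2 := by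
        rw [le_div_iff₀ (by positivity)]; linarith
      rw [hκdef, sub_mul, one_mul, one_div, inv_mul_eq_div]
      linarith
    have hest := zero_est (fun n => J (n : ℝ)) hZE (ℓ i) (k i) κ (hk1 i) hlt hκ hle
    have hlip := SS_lip hlt hlα
    rw [SS_mul hli' hα, ← hDdef] at hlip
    have hlast : 5 / (4 * κ ^ 3) / J (ℓ i) (k i) ≤ 5 / (4 * κ ^ 3) / (ℓ i : ℝ) := by gcongr
    rw [Real.norm_eq_abs]
    have e1 : (ℓ i : ℝ) * D - k i * π + π / 4 = (ℓ i * D - SS (ℓ i) (J (ℓ i) (k i))) +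
        (SS (ℓ i) (J (ℓ i) (k i)) - k i * π + π / 4) := by ring
    rw [e1]
    refine (abs_add_le _ _).trans ?_
    rw [abs_sub_comm (α * (ℓ i : ℝ))] at hlip
    exact add_le_add hlip (hest.trans hlast)
  have hfin : Tendsto (fun i => sigmaF α / 4 - ((ℓ i : ℝ) * D - k i * π + π / 4) / D) atTop
      (nhds (sigmaF α / 4)) := by
    simpa using (herr.div_const D).const_sub (sigmaF α / 4)
  refine hfin.congr ?_
  intro i
  rw [hσ]
  field_simp
  ring
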